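/- Let k be a finite algebraic extension of ℚ (a number field). For each n ∈ {0, 1, 2, 3, 5, 7, 9, 15, 27} there exists a nonzero homogeneous polynomial f of degree 3 in four variables over k defining a smooth cubic surface such that the set of lines on V(f) defined over k has exactly n elements. -/

import Mathlib

open MvPolynomial

/-- The restriction of `f` to the line spanned by `v` and `w`:
the polynomial `f (s • v + t • w)` in the two variables `s, t`. -/
noncomputable def lineRestrict {k : Type*} [CommRing k] (f : MvPolynomial (Fin 4) k)
    (v w : Fin 4 → k) : MvPolynomial (Fin 2) k :=
  aeval (fun i => C (v i) * X 0 + C (w i) * X 1) f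

/-- `W` is a line on the cubic surface `V(f)` defined over `k`: a 2-dimensional
`k`-linear subspace of `k⁴` on which `f` vanishes identically as a polynomial. -/
def IsLineOn {k : Type*} [Field k] (f : MvPolynomial (Fin 4) k)
    (W : Submodule k (Fin 4 → k)) : Prop :=
  Module.finrank k W = 2 ∧
    ∃ v w : Fin 4 → k, Submodule.span k {v, w} = W ∧ lineRestrict f v w = 0

/-- `f` defines a smooth cubic surface over `k`: `f` is a nonzero homogeneous cubic
and, over an algebraic closure, the only common zero of `f` and its partial
derivatives is the origin. -/
def IsSmoothCubic (k : Type*) [Field k] (f : MvPolynomial (Fin 4) k) : Prop :=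
  f ≠ 0 ∧ f.IsHomogeneous 3 ∧
    ∀ x : Fin 4 → AlgebraicClosure k,
      (eval x (map (algebraMap k (AlgebraicClosure k)) f) = 0 ∧
        ∀ i : Fin 4, eval x (map (algebraMap k (AlgebraicClosure k)) (pderiv i f)) = 0) →
      x = 0

theorem eval_lineRestrict {k : Type*} [CommRing k] (f : MvPolynomial (Fin 4) k)
    (v w : Fin 4 → k) (s : Fin 2 → k) :
    eval s (lineRestrict f v w) = eval (s 0 • v + s 1 • w) f := by
  rw [lineRestrict, ← coe_aeval_eq_eval, RingHom.coe_coe, ← AlgHom.comp_apply, comp_aeval,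
    ← coe_aeval_eq_eval, RingHom.coe_coe]
  congr 2
  ext i
  simp [mul_comm]

section Plane

variable {k E : Type*} [Field k] [AddCommGroup E] [Module k E]

theorem span_pair_eq_of_finrank_eq_two {W : Submodule k E} (hW : Module.finrank k W = 2)
    {v w : E} (hv : v ∈ W) (hw : w ∈ W) (h : LinearIndependent k ![v, w]) :
    Submodule.span k {v, w} = W := by
  have : FiniteDimensional k W := Module.finite_of_finrank_eq_succ hW
  refine Submodule.eq_of_le_of_finrank_eq (Submodule.span_le.2 (Set.pair_subset hv hw)) ?_
  have := finrank_span_eq_card h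
  rw [Matrix.range_cons, Matrix.range_cons, Matrix.range_empty, Set.union_empty] at this
  rw [hW]
  exact this

theorem finrank_span_pair_of_linearIndependent {v w : E} (h : LinearIndependent k ![v, w]) :
    Module.finrank k (Submodule.span k {v, w}) = 2 := by
  have := finrank_span_eq_card h
  rw [Matrix.range_cons, Matrix.range_cons, Matrix.range_empty, Set.union_empty] at this
  exact this

theorem exists_mem_linearIndependent_of_finrank_eq_two {W : Submodule k E}
    (hW : Module.finrank k W = 2) {v : E} (h0 : v ≠ 0) :
    ∃ w ∈ W, LinearIndependent k ![v, w] := by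
  by_contra! H
  have hle : W ≤ Submodule.span k {v} := fun w hw ↦ by
    have := H w hw
    rw [LinearIndependent.pair_iff' h0] at this
    push Not at this
    exact Submodule.mem_span_singleton.2 this
  have := Submodule.finrank_mono hle
  rw [hW, finrank_span_singleton h0] at this
  omega

theorem exists_mem_ne_zero_of_finrank_eq_two {W : Submodule k E}
    (hW : Module.finrank k W = 2) (l : E →ₗ[k] k) : ∃ w ∈ W, w ≠ 0 ∧ l w = 0 := by
  have : FiniteDimensional k W := Module.finite_of_finrank_eq_succ hW
  obtain ⟨w, hw, h0⟩ := Submodule.exists_mem_ne_zero_of_ne_bot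
    (LinearMap.ker_ne_bot_of_finrank_lt (f := l.comp W.subtype) (by simp [hW]))
  exact ⟨w, w.2, by simpa using h0, by simpa using hw⟩

end Plane

/-- Over an infinite field, lines on `V(f)` are the planes of `k⁴` on which `f` vanishes
pointwise. -/
theorem isLineOn_iff {k : Type*} [Field k] [Infinite k] (f : MvPolynomial (Fin 4) k)
    (W : Submodule k (Fin 4 → k)) :
    IsLineOn f W ↔ Module.finrank k W = 2 ∧ ∀ x ∈ W, eval x f = 0 := by
  refine and_congr_right fun hW ↦ ⟨?_, fun h ↦ ?_⟩
  · rintro ⟨v, w, rfl, h⟩ x hx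
    obtain ⟨s, t, rfl⟩ := Submodule.mem_span_pair.1 hx
    have := eval_lineRestrict f v w ![s, t]
    simpa [h] using this.symm
  · obtain ⟨v, hv, h0, -⟩ := exists_mem_ne_zero_of_finrank_eq_two hW 0
    obtain ⟨w, hw, hvw⟩ := exists_mem_linearIndependent_of_finrank_eq_two hW h0
    refine ⟨v, w, span_pair_eq_of_finrank_eq_two hW hv hw hvw, MvPolynomial.funext fun s ↦ ?_⟩
    rw [eval_lineRestrict, map_zero]
    exact h _ (W.add_mem (W.smul_mem _ hv) (W.smul_mem _ hw))

/-- A quadratic polynomial function which vanishes at `0`, `1` and `-1` is zero. -/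
theorem quadratic_coeffs_eq_zero {k : Type*} [Field k] [CharZero k] {a b c : k}
    (h : ∀ t : k, a + b * t + c * t ^ 2 = 0) : a = 0 ∧ b = 0 ∧ c = 0 := by
  have h0 := h 0
  have h1 := h 1
  have h2 := h (-1)
  grind

theorem linear_eq_zero_or_of_mul_eq_zero {k : Type*} [Field k] [CharZero k] {a b c d : k}
    (h : ∀ t : k, (a + b * t) * (c + d * t) = 0) : (a = 0 ∧ b = 0) ∨ (c = 0 ∧ d = 0) := by
  obtain ⟨h0, h1, h2⟩ := quadratic_coeffs_eq_zero (a := a * c) (b := a * d + b * c) (c := b * d)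
    (fun t ↦ by linear_combination h t)
  rcases mul_eq_zero.1 h0 with rfl | rfl <;> rcases mul_eq_zero.1 h2 with rfl | rfl <;>
    simp_all

section QuinticCubic

variable {k : Type*} [Field k]

/-- The cubic form attached to a monic quintic `R`; its surface contains the skew lines
`x₀ = x₁ = 0` and `x₂ = x₃ = 0`, and the common transversals of these two lines correspond to
the roots of `R`. -/
noncomputable def quinticCubic (R : Polynomial k) : MvPolynomial (Fin 4) k :=
  X 0 ^ 2 * X 2 + X 1 ^ 2 * X 3
    + X 0 * (C (R.coeff 1) * X 2 ^ 2 - C (R.coeff 3) * X 2 * X 3 + X 3 ^ 2)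
    + X 1 * (C (R.coeff 0) * X 2 ^ 2 - C (R.coeff 2) * X 2 * X 3 + C (R.coeff 4) * X 3 ^ 2)

theorem quinticCubic_isHomogeneous (R : Polynomial k) : (quinticCubic R).IsHomogeneous 3 := by
  have hX (i : Fin 4) : (X i : MvPolynomial (Fin 4) k).IsHomogeneous 1 := isHomogeneous_X k i
  have hC (a : k) : (C a : MvPolynomial (Fin 4) k).IsHomogeneous 0 := isHomogeneous_C _ a
  have hQ (a b : k) (p : MvPolynomial (Fin 4) k) (hp : p.IsHomogeneous 2) :
      (C a * X 2 ^ 2 - C b * X 2 * X 3 + p).IsHomogeneous 2 :=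
    ((((hC a).mul ((hX 2).pow 2))).sub (((hC b).mul (hX 2)).mul (hX 3))).add hp
  exact (((((hX 0).pow 2).mul (hX 2)).add (((hX 1).pow 2).mul (hX 3))).add
    ((hX 0).mul (hQ _ _ _ ((hX 3).pow 2)))).add
    ((hX 1).mul (hQ _ _ _ ((hC _).mul ((hX 3).pow 2))))

theorem eval_quinticCubic (R : Polynomial k) (x : Fin 4 → k) :
    eval x (quinticCubic R) = x 0 ^ 2 * x 2 + x 1 ^ 2 * x 3
      + x 0 * (R.coeff 1 * x 2 ^ 2 - R.coeff 3 * x 2 * x 3 + x 3 ^ 2)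
      + x 1 * (R.coeff 0 * x 2 ^ 2 - R.coeff 2 * x 2 * x 3 + R.coeff 4 * x 3 ^ 2) := by
  simp [quinticCubic]

theorem quinticCubic_ne_zero (R : Polynomial k) : quinticCubic R ≠ 0 := by
  intro h
  have := eval_quinticCubic R ![1, 0, 0, 1]
  simp [h] at this

theorem eq_of_monic_of_natDegree_eq_five {R : Polynomial k} (hR : R.Monic)
    (hd : R.natDegree = 5) :
    R = .X ^ 5 + .C (R.coeff 4) * .X ^ 4 + .C (R.coeff 3) * .X ^ 3 + .C (R.coeff 2) * .X ^ 2
      + .C (R.coeff 1) * .X + .C (R.coeff 0) := by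
  conv_lhs => rw [hR.as_sum, hd]
  simp only [Finset.sum_range_succ, Finset.sum_range_zero]
  ring

theorem eval_of_monic_of_natDegree_eq_five {R : Polynomial k} (hR : R.Monic)
    (hd : R.natDegree = 5) (z : k) :
    R.eval z = z ^ 5 + R.coeff 4 * z ^ 4 + R.coeff 3 * z ^ 3 + R.coeff 2 * z ^ 2
      + R.coeff 1 * z + R.coeff 0 := by
  conv_lhs => rw [eq_of_monic_of_natDegree_eq_five hR hd]
  simp

/-- If the even and the odd part of a monic quintic `R` vanish at `w = z ^ 2`, then `X ^ 2 - w`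
divides `R`. -/
theorem X_sq_sub_C_dvd {R : Polynomial k} (hR : R.Monic) (hd : R.natDegree = 5) {w : k}
    (hodd : w ^ 2 + R.coeff 3 * w + R.coeff 1 = 0)
    (heven : R.coeff 4 * w ^ 2 + R.coeff 2 * w + R.coeff 0 = 0) :
    (Polynomial.X ^ 2 + Polynomial.C (-w)) ∣ R := by
  refine ⟨.X ^ 3 + .C (R.coeff 4) * .X ^ 2 + .C (R.coeff 3 + w) * .X
    + .C (R.coeff 2 + R.coeff 4 * w), ?_⟩
  have h1 : R.coeff 1 = - (w ^ 2 + R.coeff 3 * w) := by linear_combination hodd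
  have h0 : R.coeff 0 = - (R.coeff 4 * w ^ 2 + R.coeff 2 * w) := by linear_combination heven
  conv_lhs => rw [eq_of_monic_of_natDegree_eq_five hR hd, h1, h0]
  simp only [map_add, map_neg, map_mul, map_pow]
  ring

variable (k) in
/-- The line `x₀ = x₁ = 0`. -/
def baseLine : Submodule k (Fin 4 → k) := Submodule.span k {![0, 0, 1, 0], ![0, 0, 0, 1]}

/-- The transversal through a root `z`. -/
def transversalLine (z : k) : Submodule k (Fin 4 → k) :=
  Submodule.span k {![z, 1, 0, 0], ![0, 0, 1, -z ^ 2]}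

/-- The third line in the plane spanned by `baseLine k` and the transversal through `z`. -/
noncomputable def residualLine (R : Polynomial k) (z : k) : Submodule k (Fin 4 → k) :=
  Submodule.span k
    {![z * (z * R.coeff 3 + R.coeff 2 + z ^ 2 * (z + R.coeff 4)),
        z * R.coeff 3 + R.coeff 2 + z ^ 2 * (z + R.coeff 4), 1, 0],
      ![-z * (z + R.coeff 4), -(z + R.coeff 4), 0, 1]}

/-- The graph of the linear map `k² → k²` with matrix `!![φ 0, φ 1; φ 2, φ 3]`. -/
def graphLine (φ : Fin 4 → k) : Submodule k (Fin 4 → k) :=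
  Submodule.span k {![1, 0, φ 0, φ 2], ![0, 1, φ 1, φ 3]}

theorem mem_baseLine {x : Fin 4 → k} : x ∈ baseLine k ↔ x 0 = 0 ∧ x 1 = 0 := by
  rw [baseLine, Submodule.mem_span_pair]
  constructor
  · rintro ⟨a, b, rfl⟩
    simp
  · rintro ⟨h0, h1⟩
    refine ⟨x 2, x 3, ?_⟩
    ext i
    fin_cases i <;> simp [h0, h1]

theorem mem_transversalLine {z : k} {x : Fin 4 → k} :
    x ∈ transversalLine z ↔ x 0 = z * x 1 ∧ x 3 = -z ^ 2 * x 2 := by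
  rw [transversalLine, Submodule.mem_span_pair]
  constructor
  · rintro ⟨a, b, rfl⟩
    simp [mul_comm]
  · rintro ⟨h0, h1⟩
    refine ⟨x 1, x 2, ?_⟩
    ext i
    fin_cases i <;> simp [h0, h1, mul_comm]

theorem mem_residualLine {R : Polynomial k} {z : k} {x : Fin 4 → k} :
    x ∈ residualLine R z ↔ x 0 = z * x 1 ∧
      x 1 = (z * R.coeff 3 + R.coeff 2 + z ^ 2 * (z + R.coeff 4)) * x 2
        - (z + R.coeff 4) * x 3 := by
  rw [residualLine, Submodule.mem_span_pair]
  constructor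
  · rintro ⟨a, b, rfl⟩
    constructor <;> simp <;> ring
  · rintro ⟨h0, h1⟩
    refine ⟨x 2, x 3, ?_⟩
    ext i
    fin_cases i <;> simp [h0, h1] <;> ring

theorem mem_graphLine {φ : Fin 4 → k} {x : Fin 4 → k} :
    x ∈ graphLine φ ↔ x 2 = φ 0 * x 0 + φ 1 * x 1 ∧ x 3 = φ 2 * x 0 + φ 3 * x 1 := by
  rw [graphLine, Submodule.mem_span_pair]
  constructor
  · rintro ⟨a, b, rfl⟩
    constructor <;> simp <;> ring
  · rintro ⟨h0, h1⟩
    refine ⟨x 0, x 1, ?_⟩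
    ext i
    fin_cases i <;> simp [h0, h1] <;> ring

/-- Two vectors with an identity block in the coordinates `i`, `j` are linearly independent. -/
theorem linearIndependent_pair_of_coords {v w : Fin 4 → k} {i j : Fin 4} (hvi : v i = 1)
    (hwi : w i = 0) (hwj : w j = 1) : LinearIndependent k ![v, w] := by
  rw [LinearIndependent.pair_iff]
  intro s t h
  have hi : s = 0 := by simpa [hvi, hwi] using congrFun h i
  refine ⟨hi, ?_⟩
  simpa [hi, hwj] using congrFun h j

theorem finrank_baseLine : Module.finrank k (baseLine k) = 2 :=
  finrank_span_pair_of_linearIndependent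
    (linearIndependent_pair_of_coords (i := 2) (j := 3) rfl rfl rfl)

theorem finrank_transversalLine (z : k) : Module.finrank k (transversalLine z) = 2 :=
  finrank_span_pair_of_linearIndependent
    (linearIndependent_pair_of_coords (i := 1) (j := 2) rfl rfl rfl)

theorem finrank_residualLine (R : Polynomial k) (z : k) :
    Module.finrank k (residualLine R z) = 2 :=
  finrank_span_pair_of_linearIndependent
    (linearIndependent_pair_of_coords (i := 2) (j := 3) rfl rfl rfl)

theorem finrank_graphLine (φ : Fin 4 → k) : Module.finrank k (graphLine φ) = 2 :=
  finrank_span_pair_of_linearIndependent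
    (linearIndependent_pair_of_coords (i := 0) (j := 1) rfl rfl rfl)

/-- The matrices whose graphs lie on the surface of `quinticCubic R`. -/
def graphMatrices (R : Polynomial k) : Set (Fin 4 → k) :=
  {φ | ∀ x ∈ graphLine φ, eval x (quinticCubic R) = 0}

theorem eq_of_le_of_finrank_eq_two {W W' : Submodule k (Fin 4 → k)}
    (hW : Module.finrank k W = 2) (hW' : Module.finrank k W' = 2) (h : W ≤ W') : W = W' :=
  Submodule.eq_of_le_of_finrank_eq h (hW.trans hW'.symm)

/-- A plane in `k⁴` is a graph or contains a nonzero vector of `baseLine k`. -/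
theorem eq_graphLine_or_exists_mem_baseLine {W : Submodule k (Fin 4 → k)}
    (hW : Module.finrank k W = 2) :
    (∃ φ, W = graphLine φ) ∨ ∃ v ∈ W, v ≠ 0 ∧ v ∈ baseLine k := by
  by_contra! ⟨hgraph, hbase⟩
  obtain ⟨v, hv, hv0, hv1⟩ := exists_mem_ne_zero_of_finrank_eq_two hW (LinearMap.proj 1)
  obtain ⟨w, hw, hw0, hw1⟩ := exists_mem_ne_zero_of_finrank_eq_two hW (LinearMap.proj 0)
  simp only [LinearMap.coe_proj, Function.eval] at hv1 hw1
  have hv2 : v 0 ≠ 0 := fun h ↦ hbase v hv hv0 (mem_baseLine.2 ⟨h, hv1⟩)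
  have hw2 : w 1 ≠ 0 := fun h ↦ hbase w hw hw0 (mem_baseLine.2 ⟨hw1, h⟩)
  refine hgraph ![v 2 / v 0, w 2 / w 1, v 3 / v 0, w 3 / w 1] ?_
  refine (span_pair_eq_of_finrank_eq_two hW ?_ ?_
    (linearIndependent_pair_of_coords (i := 0) (j := 1) rfl rfl rfl)).symm
  · convert W.smul_mem (v 0)⁻¹ hv using 1
    ext i
    fin_cases i <;> simp [hv1, hv2, div_eq_inv_mul]
  · convert W.smul_mem (w 1)⁻¹ hw using 1
    ext i
    fin_cases i <;> simp [hw1, hw2, div_eq_inv_mul]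

/-- On the plane `x₀ = z x₁` through `baseLine k`, where `z` is a root of `R`, the form
`quinticCubic R` splits into linear factors. -/
theorem eval_quinticCubic_of_root {R : Polynomial k} (hR : R.Monic) (hd : R.natDegree = 5)
    {z : k} (hz : R.IsRoot z) {x : Fin 4 → k} (hx : x 0 = z * x 1) :
    eval x (quinticCubic R) = x 1 * (z ^ 2 * x 2 + x 3)
      * (x 1 - ((z * R.coeff 3 + R.coeff 2 + z ^ 2 * (z + R.coeff 4)) * x 2
        - (z + R.coeff 4) * x 3)) := by
  rw [Polynomial.IsRoot, eval_of_monic_of_natDegree_eq_five hR hd] at hz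
  rw [eval_quinticCubic, hx]
  linear_combination x 1 * x 2 ^ 2 * hz

theorem eq_baseLine_or_of_mem_baseLine [CharZero k] {R : Polynomial k} (hR : R.Monic)
    (hd : R.natDegree = 5) {W : Submodule k (Fin 4 → k)} (hW : Module.finrank k W = 2)
    (hF : ∀ x ∈ W, eval x (quinticCubic R) = 0) {v : Fin 4 → k} (hv : v ∈ W) (hv0 : v ≠ 0)
    (hvb : v ∈ baseLine k) :
    W = baseLine k ∨ ∃ z, R.IsRoot z ∧ (W = transversalLine z ∨ W = residualLine R z) := by
  rw [or_iff_not_imp_left]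
  intro hWb
  obtain ⟨w, hw, hvw⟩ := exists_mem_linearIndependent_of_finrank_eq_two hW hv0
  have hspan := span_pair_eq_of_finrank_eq_two hW hv hw hvw
  obtain ⟨hv2, hv3⟩ := mem_baseLine.1 hvb
  have hv23 : v 2 ≠ 0 ∨ v 3 ≠ 0 := by
    by_contra! h
    exact hv0 (by ext i; fin_cases i <;> simp [*])
  have hw01 : w 0 ≠ 0 ∨ w 1 ≠ 0 := by
    by_contra! h
    refine hWb (eq_of_le_of_finrank_eq_two hW finrank_baseLine ?_)
    rw [← hspan]
    exact Submodule.span_le.2 (Set.pair_subset hvb (mem_baseLine.2 h))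
  have key : ∀ t, eval (w + t • v) (quinticCubic R) = 0 := fun t ↦
    hF _ (W.add_mem hw (W.smul_mem t hv))
  simp only [eval_quinticCubic, Pi.add_apply, Pi.smul_apply, smul_eq_mul, hv2, hv3, mul_zero,
    add_zero] at key
  obtain ⟨hc0, hc1, hc2⟩ := quadratic_coeffs_eq_zero
    (a := w 0 ^ 2 * w 2 + w 1 ^ 2 * w 3
      + w 0 * (R.coeff 1 * w 2 ^ 2 - R.coeff 3 * w 2 * w 3 + w 3 ^ 2)
      + w 1 * (R.coeff 0 * w 2 ^ 2 - R.coeff 2 * w 2 * w 3 + R.coeff 4 * w 3 ^ 2))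
    (b := w 0 ^ 2 * v 2 + w 1 ^ 2 * v 3
      + w 0 * (2 * R.coeff 1 * w 2 * v 2 - R.coeff 3 * (w 2 * v 3 + w 3 * v 2) + 2 * w 3 * v 3)
      + w 1 * (2 * R.coeff 0 * w 2 * v 2 - R.coeff 2 * (w 2 * v 3 + w 3 * v 2)
        + 2 * R.coeff 4 * w 3 * v 3))
    (c := w 0 * (R.coeff 1 * v 2 ^ 2 - R.coeff 3 * v 2 * v 3 + v 3 ^ 2)
      + w 1 * (R.coeff 0 * v 2 ^ 2 - R.coeff 2 * v 2 * v 3 + R.coeff 4 * v 3 ^ 2))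
    (fun t ↦ by linear_combination key t)
  have hroot : w 0 ^ 5 + R.coeff 4 * w 0 ^ 4 * w 1 + R.coeff 3 * w 0 ^ 3 * w 1 ^ 2
      + R.coeff 2 * w 0 ^ 2 * w 1 ^ 3 + R.coeff 1 * w 0 * w 1 ^ 4 + R.coeff 0 * w 1 ^ 5 = 0 := by
    have hq (y2 y3 : k) (hA : w 0 ^ 2 * y2 + w 1 ^ 2 * y3 = 0) (hy : y2 ≠ 0 ∨ y3 ≠ 0)
        (hQ : w 0 * (R.coeff 1 * y2 ^ 2 - R.coeff 3 * y2 * y3 + y3 ^ 2)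
          + w 1 * (R.coeff 0 * y2 ^ 2 - R.coeff 2 * y2 * y3 + R.coeff 4 * y3 ^ 2) = 0) :
        w 0 ^ 5 + R.coeff 4 * w 0 ^ 4 * w 1 + R.coeff 3 * w 0 ^ 3 * w 1 ^ 2
          + R.coeff 2 * w 0 ^ 2 * w 1 ^ 3 + R.coeff 1 * w 0 * w 1 ^ 4 + R.coeff 0 * w 1 ^ 5 = 0 := by
      obtain ⟨c, rfl, rfl⟩ : ∃ c, y2 = c * w 1 ^ 2 ∧ y3 = -c * w 0 ^ 2 := by
        by_cases h : w 1 = 0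
        · have h0 := hw01.resolve_right (not_not.2 h)
          refine ⟨-y3 / w 0 ^ 2, ?_, by field_simp⟩
          have : w 0 ^ 2 * y2 = 0 := by simpa [h] using hA
          simpa [h, h0] using this
        · refine ⟨y2 / w 1 ^ 2, by field_simp, ?_⟩
          field_simp
          linear_combination hA
      have hc : c ≠ 0 := by
        rintro rfl
        simp at hy
      refine (mul_eq_zero.1 ?_).resolve_left (pow_ne_zero 2 hc)
      linear_combination hQ
    by_cases hA : w 0 ^ 2 * v 2 + w 1 ^ 2 * v 3 = 0
    · exact hq _ _ hA hv23 hc2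
    · set A := w 0 ^ 2 * v 2 + w 1 ^ 2 * v 3 with hAv
      set B := w 0 ^ 2 * w 2 + w 1 ^ 2 * w 3 with hBv
      refine hq (A * w 2 - B * v 2) (A * w 3 - B * v 3) (by linear_combination B * hAv - A * hBv)
        ?_ (by linear_combination A ^ 2 * hc0 - A * B * hc1 + B ^ 2 * hc2)
      by_contra! h
      refine pow_ne_zero 2 hA ?_
      linear_combination A * hc1 - 2 * B * hc2
        - w 0 * (2 * R.coeff 1 * h.1 * v 2 - R.coeff 3 * (h.1 * v 3 + h.2 * v 2) + 2 * h.2 * v 3)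
        - w 1 * (2 * R.coeff 0 * h.1 * v 2 - R.coeff 2 * (h.1 * v 3 + h.2 * v 2)
          + 2 * R.coeff 4 * h.2 * v 3)
  have hw1 : w 1 ≠ 0 := by
    intro h
    simp [h] at hroot hw01
    exact hw01 hroot
  refine ⟨w 0 / w 1, ?_⟩
  set z := w 0 / w 1
  have hwz : w 0 = z * w 1 := (div_mul_cancel₀ _ hw1).symm
  have hz : R.IsRoot z := by
    rw [Polynomial.IsRoot, eval_of_monic_of_natDegree_eq_five hR hd]
    rw [hwz] at hroot
    refine (mul_eq_zero.1 ?_).resolve_right (pow_ne_zero 5 hw1)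
    linear_combination hroot
  refine ⟨hz, ?_⟩
  have hlin : ∀ t, (z ^ 2 * (w 2 + t * v 2) + (w 3 + t * v 3))
      * (w 1 - ((z * R.coeff 3 + R.coeff 2 + z ^ 2 * (z + R.coeff 4)) * (w 2 + t * v 2)
        - (z + R.coeff 4) * (w 3 + t * v 3))) = 0 := fun t ↦ by
    have := eval_quinticCubic_of_root hR hd hz (x := w + t • v) (by simp [hv2, hv3, hwz])
    rw [hF _ (W.add_mem hw (W.smul_mem t hv))] at this
    simpa [hv3, hw1, mul_assoc] using this.symm
  generalize hm : z * R.coeff 3 + R.coeff 2 + z ^ 2 * (z + R.coeff 4) = m at hlin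
  generalize hn : z + R.coeff 4 = n at hlin
  have := linear_eq_zero_or_of_mul_eq_zero (a := z ^ 2 * w 2 + w 3) (b := z ^ 2 * v 2 + v 3)
    (c := w 1 - (m * w 2 - n * w 3)) (d := -(m * v 2 - n * v 3))
    (fun t ↦ by linear_combination hlin t)
  refine this.imp (fun h ↦ eq_of_le_of_finrank_eq_two hW (finrank_transversalLine z) ?_)
    (fun h ↦ eq_of_le_of_finrank_eq_two hW (finrank_residualLine R z) ?_) <;>
    rw [← hspan] <;> refine Submodule.span_le.2 (Set.pair_subset ?_ ?_)
  · exact mem_transversalLine.2 ⟨by simp [hv2, hv3], by linear_combination h.2⟩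
  · exact mem_transversalLine.2 ⟨hwz, by linear_combination h.1⟩
  · refine mem_residualLine.2 ⟨by simp [hv2, hv3], ?_⟩
    rw [hm, hn, hv3]
    linear_combination h.2
  · refine mem_residualLine.2 ⟨hwz, ?_⟩
    rw [hm, hn]
    linear_combination h.1

theorem mem_graphMatrices [CharZero k] {R : Polynomial k} {φ : Fin 4 → k} :
    φ ∈ graphMatrices R ↔
      φ 0 + R.coeff 1 * φ 0 ^ 2 - R.coeff 3 * φ 0 * φ 2 + φ 2 ^ 2 = 0 ∧
      φ 1 + 2 * R.coeff 1 * φ 0 * φ 1 - R.coeff 3 * (φ 0 * φ 3 + φ 1 * φ 2) + 2 * φ 2 * φ 3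
        + R.coeff 0 * φ 0 ^ 2 - R.coeff 2 * φ 0 * φ 2 + R.coeff 4 * φ 2 ^ 2 = 0 ∧
      φ 2 + R.coeff 1 * φ 1 ^ 2 - R.coeff 3 * φ 1 * φ 3 + φ 3 ^ 2 + 2 * R.coeff 0 * φ 0 * φ 1
        - R.coeff 2 * (φ 0 * φ 3 + φ 1 * φ 2) + 2 * R.coeff 4 * φ 2 * φ 3 = 0 ∧
      φ 3 + R.coeff 0 * φ 1 ^ 2 - R.coeff 2 * φ 1 * φ 3 + R.coeff 4 * φ 3 ^ 2 = 0 := by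
  constructor
  · intro h
    have key (s t : k) := h ![s, t, φ 0 * s + φ 1 * t, φ 2 * s + φ 3 * t]
      (mem_graphLine.2 ⟨rfl, rfl⟩)
    simp only [eval_quinticCubic, Matrix.cons_val] at key
    have h10 := key 1 0
    have h01 := key 0 1
    have h11 := key 1 1
    have h12 := key 1 (-1)
    refine ⟨by linear_combination h10, mul_left_cancel₀ (two_ne_zero (α := k)) ?_,
      mul_left_cancel₀ (two_ne_zero (α := k)) ?_, by linear_combination h01⟩
    · linear_combination h11 - h12 - 2 * h01
    · linear_combination h11 + h12 - 2 * h10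
  · rintro ⟨h3, h2, h1, h0⟩ x hx
    obtain ⟨hx2, hx3⟩ := mem_graphLine.1 hx
    rw [eval_quinticCubic, hx2, hx3]
    linear_combination x 0 ^ 3 * h3 + x 0 ^ 2 * x 1 * h2 + x 0 * x 1 ^ 2 * h1 + x 1 ^ 3 * h0

/-- The matrix proportional to `!![1, b; c, d]` whose graph can lie on the surface of
`quinticCubic R`. -/
noncomputable def cubicMatrix (R : Polynomial k) (b c d : k) : Fin 4 → k :=
  -(c ^ 2 - R.coeff 3 * c + R.coeff 1)⁻¹ • ![1, b, c, d]

theorem cubicMatrix_inj {R : Polynomial k} {b c d b' c' d' : k}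
    (hK : c ^ 2 - R.coeff 3 * c + R.coeff 1 ≠ 0)
    (h : cubicMatrix R b c d = cubicMatrix R b' c' d') : b = b' ∧ c = c' ∧ d = d' := by
  have h0 := congrFun h 0
  have h1 := congrFun h 1
  have h2 := congrFun h 2
  have h3 := congrFun h 3
  simp only [cubicMatrix, Pi.smul_apply, Matrix.cons_val, smul_eq_mul, mul_one] at h0 h1 h2 h3
  have hK' := neg_ne_zero.2 (inv_ne_zero hK)
  rw [← h0] at h1 h2 h3
  exact ⟨mul_left_cancel₀ hK' h1, mul_left_cancel₀ hK' h2, mul_left_cancel₀ hK' h3⟩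

theorem mem_graphMatrices_iff [CharZero k] {R : Polynomial k} {φ : Fin 4 → k} :
    φ ∈ graphMatrices R ↔ φ = 0 ∨ ∃ b c d, c ^ 2 - R.coeff 3 * c + R.coeff 1 ≠ 0 ∧
      (b * c ^ 2 = R.coeff 1 * b - R.coeff 3 * d + 2 * c * d + R.coeff 0 - R.coeff 2 * c
        + R.coeff 4 * c ^ 2 ∧
      c * (c ^ 2 - R.coeff 3 * c + R.coeff 1) = R.coeff 1 * b ^ 2 - R.coeff 3 * b * d + d ^ 2
        + 2 * R.coeff 0 * b - R.coeff 2 * (d + b * c) + 2 * R.coeff 4 * c * d ∧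
      d * (c ^ 2 - R.coeff 3 * c + R.coeff 1) = R.coeff 0 * b ^ 2 - R.coeff 2 * b * d
        + R.coeff 4 * d ^ 2) ∧ φ = cubicMatrix R b c d := by
  rw [mem_graphMatrices]
  constructor
  · rintro ⟨h3, h2, h1, h0⟩
    rw [or_iff_not_imp_left]
    intro hφ
    have ha0 : φ 0 ≠ 0 := by
      intro ha
      have hc : φ 2 = 0 := by simpa [ha] using h3
      have hb : φ 1 = 0 := by simpa [ha, hc] using h2
      have hd : φ 3 = 0 := by simpa [ha, hb, hc] using h1
      exact hφ (by ext i; fin_cases i <;> assumption)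
    obtain ⟨a, b, c, d, ha, rfl⟩ : ∃ a b c d : k, a ≠ 0 ∧ φ = ![a, a * b, a * c, a * d] := by
      refine ⟨φ 0, φ 1 / φ 0, φ 2 / φ 0, φ 3 / φ 0, ha0, ?_⟩
      ext i
      fin_cases i <;> simp [mul_div_cancel₀, ha0]
    clear hφ
    simp only [Matrix.cons_val] at h0 h1 h2 h3
    have hK : a * (c ^ 2 - R.coeff 3 * c + R.coeff 1) = -1 := by
      refine mul_left_cancel₀ ha ?_
      linear_combination h3
    have hK0 : c ^ 2 - R.coeff 3 * c + R.coeff 1 ≠ 0 := by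
      intro h
      simp [h] at hK
    refine ⟨b, c, d, hK0, ⟨?_, ?_, ?_⟩, ?_⟩
    · refine mul_left_cancel₀ (pow_ne_zero 2 ha) ?_
      linear_combination -h2 + a * b * hK
    · refine mul_left_cancel₀ (pow_ne_zero 2 ha) ?_
      linear_combination -h1 + a * c * hK
    · refine mul_left_cancel₀ (pow_ne_zero 2 ha) ?_
      linear_combination -h0 + a * d * hK
    · have : a = -(c ^ 2 - R.coeff 3 * c + R.coeff 1)⁻¹ :=
        neg_eq_iff_eq_neg.1 (eq_inv_of_mul_eq_one_left (by linear_combination -hK))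
      rw [cubicMatrix, ← this]
      ext i
      fin_cases i <;> simp
  · rintro (rfl | ⟨b, c, d, hK, ⟨h2, h1, h0⟩, rfl⟩)
    · simp
    · obtain ⟨a, ha⟩ : ∃ a, a = -(c ^ 2 - R.coeff 3 * c + R.coeff 1)⁻¹ := ⟨_, rfl⟩
      have hK : a * (c ^ 2 - R.coeff 3 * c + R.coeff 1) = -1 := by
        rw [ha, neg_mul, inv_mul_cancel₀ hK]
      rw [cubicMatrix, ← ha]
      simp only [Pi.smul_apply, Matrix.cons_val, smul_eq_mul]
      refine ⟨?_, ?_, ?_, ?_⟩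
      · linear_combination a * hK
      · linear_combination a * b * hK - a ^ 2 * h2
      · linear_combination a * c * hK - a ^ 2 * h1
      · linear_combination a * d * hK - a ^ 2 * h0

theorem eq_of_monic_of_natDegree_eq_three {g : Polynomial k} (hg : g.Monic)
    (hd : g.natDegree = 3) :
    g = .X ^ 3 + .C (g.coeff 2) * .X ^ 2 + .C (g.coeff 1) * .X + .C (g.coeff 0) := by
  conv_lhs => rw [hg.as_sum, hd]
  simp only [Finset.sum_range_succ, Finset.sum_range_zero]
  ring

theorem cubic_monic_natDegree (b c d : k) :
    (.X ^ 3 + .C b * .X ^ 2 + .C c * .X + .C d : Polynomial k).Monic ∧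
      (.X ^ 3 + .C b * .X ^ 2 + .C c * .X + .C d : Polynomial k).natDegree = 3 := by
  constructor
  · monicity!
  · compute_degree!

theorem quadratic_polynomial_eq_zero_iff {a b c : k} :
    (.C a * .X ^ 2 + .C b * .X + .C c : Polynomial k) = 0 ↔ a = 0 ∧ b = 0 ∧ c = 0 := by
  refine ⟨fun h ↦ ⟨?_, ?_, ?_⟩, ?_⟩
  · simpa [Polynomial.coeff_X, Polynomial.coeff_C] using congrArg (Polynomial.coeff · 2) h
  · simpa [Polynomial.coeff_X, Polynomial.coeff_C] using congrArg (Polynomial.coeff · 1) h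
  · simpa [Polynomial.coeff_X, Polynomial.coeff_C] using congrArg (Polynomial.coeff · 0) h
  · rintro ⟨rfl, rfl, rfl⟩
    simp

/-- A monic cubic factor of a monic quintic in terms of coefficients. -/
theorem cubic_dvd_iff {R : Polynomial k} (hR : R.Monic) (hd : R.natDegree = 5) {b c d : k} :
    (.X ^ 3 + .C b * .X ^ 2 + .C c * .X + .C d : Polynomial k) ∣ R ↔
      R.coeff 2 = d + (R.coeff 4 - b) * c + (R.coeff 3 - c - (R.coeff 4 - b) * b) * b ∧
      R.coeff 1 = (R.coeff 4 - b) * d + (R.coeff 3 - c - (R.coeff 4 - b) * b) * c ∧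
      R.coeff 0 = (R.coeff 3 - c - (R.coeff 4 - b) * b) * d := by
  set p := R.coeff 4 - b with hp
  set q := R.coeff 3 - c - p * b with hq
  obtain ⟨hm, h3⟩ := cubic_monic_natDegree b c d
  have hrem : R - (.X ^ 3 + .C b * .X ^ 2 + .C c * .X + .C d) * (.X ^ 2 + .C p * .X + .C q)
      = .C (R.coeff 2 - (d + p * c + q * b)) * .X ^ 2 + .C (R.coeff 1 - (p * d + q * c)) * .X
        + .C (R.coeff 0 - q * d) := by
    have h4 : R.coeff 4 = p + b := by rw [hp]; ring
    have h3' : R.coeff 3 = q + p * b + c := by rw [hq]; ring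
    conv_lhs => rw [eq_of_monic_of_natDegree_eq_five hR hd, h4, h3']
    simp only [map_add, map_sub, map_mul]
    ring
  constructor
  · intro h
    have hzero := Polynomial.eq_zero_of_dvd_of_natDegree_lt
      (dvd_sub h (dvd_mul_right _ (.X ^ 2 + .C p * .X + .C q))) (by
        rw [h3, hrem]
        exact lt_of_le_of_lt Polynomial.natDegree_quadratic_le (by norm_num))
    rw [hrem, quadratic_polynomial_eq_zero_iff] at hzero
    exact ⟨sub_eq_zero.1 hzero.1, sub_eq_zero.1 hzero.2.1, sub_eq_zero.1 hzero.2.2⟩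
  · rintro ⟨h2, h1, h0⟩
    refine ⟨_, sub_eq_zero.1 (hrem.trans ?_)⟩
    rw [h2, h1, h0]
    simp

theorem ne_zero_of_isRoot {R : Polynomial k} (hR : R.Monic) (hd : R.natDegree = 5)
    (hA : ∀ q : k, ¬ (.X ^ 2 + .C q : Polynomial k) ∣ R) {z : k} (hz : R.IsRoot z) :
    (-z ^ 2) ^ 2 - R.coeff 3 * (-z ^ 2) + R.coeff 1 ≠ 0 := by
  intro hK
  rw [Polynomial.IsRoot, eval_of_monic_of_natDegree_eq_five hR hd] at hz
  exact hA (-z ^ 2) (X_sq_sub_C_dvd hR hd (w := z ^ 2) (by linear_combination hK)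
    (by linear_combination hz - z * hK))

theorem ne_mul_and_ne_zero_of_cubic_dvd {R : Polynomial k} (hR : R.Monic)
    (hd : R.natDegree = 5) (hA : ∀ q : k, ¬ (.X ^ 2 + .C q : Polynomial k) ∣ R) {b c d : k}
    (h : (.X ^ 3 + .C b * .X ^ 2 + .C c * .X + .C d : Polynomial k) ∣ R) :
    d ≠ b * c ∧ c ^ 2 - R.coeff 3 * c + R.coeff 1 ≠ 0 := by
  obtain ⟨h2, h1, h0⟩ := (cubic_dvd_iff hR hd).1 h
  have hbc : d ≠ b * c := by
    rintro rfl
    refine hA c (Dvd.dvd.trans ⟨.X + .C b, ?_⟩ h)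
    rw [map_mul]
    ring
  refine ⟨hbc, fun hK ↦ ?_⟩
  have hp : R.coeff 4 - b = 0 := by
    refine (mul_eq_zero.1 ?_).resolve_right (sub_ne_zero.2 hbc)
    linear_combination hK - h1
  rw [hp] at h0 h1 h2
  refine hA (R.coeff 3 - c) ?_
  have := X_sq_sub_C_dvd hR hd (w := c - R.coeff 3) (by linear_combination h1)
    (by linear_combination (c - R.coeff 3) ^ 2 * hp + (c - R.coeff 3) * h2 + h0)
  rwa [neg_sub] at this

/-- The nonzero elements of `graphMatrices R` come from the roots and from the cubic factors
of `R`. -/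
theorem mem_graphMatrices_iff_root_or_cubic [CharZero k] {R : Polynomial k} (hR : R.Monic)
    (hd : R.natDegree = 5) (hA : ∀ q : k, ¬ (.X ^ 2 + .C q : Polynomial k) ∣ R)
    {φ : Fin 4 → k} :
    φ ∈ graphMatrices R ↔ φ = 0 ∨ (∃ z, R.IsRoot z ∧ φ = cubicMatrix R z (-z ^ 2) (-z ^ 3)) ∨
      ∃ b c d, (.X ^ 3 + .C b * .X ^ 2 + .C c * .X + .C d : Polynomial k) ∣ R ∧
        φ = cubicMatrix R b c d := by
  rw [mem_graphMatrices_iff]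
  refine or_congr_right ⟨?_, ?_⟩
  · rintro ⟨b, c, d, hK, ⟨h2, h1, h0⟩, rfl⟩
    by_cases hbc : d = b * c
    · have hc : c = -b ^ 2 := by
        subst hbc
        refine eq_neg_of_add_eq_zero_left ((mul_eq_zero.1 ?_).resolve_left hK)
        linear_combination h1 - 2 * b * h2
      subst hc
      refine .inl ⟨b, ?_, by rw [hbc]; ring_nf⟩
      rw [Polynomial.IsRoot, eval_of_monic_of_natDegree_eq_five hR hd]
      rw [hbc] at h2
      linear_combination -h2
    · refine .inr ⟨b, c, d, (cubic_dvd_iff hR hd).2 ?_, rfl⟩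
      have hD : (d - b * c) ^ 2 ≠ 0 := pow_ne_zero 2 (sub_ne_zero.2 hbc)
      refine ⟨mul_left_cancel₀ hD ?_, mul_left_cancel₀ hD ?_, mul_left_cancel₀ hD ?_⟩
      · linear_combination (-2 * b * d - b ^ 4 + b ^ 2 * c) * h2 + (d + b ^ 3) * h1
          - (b ^ 2 + c) * h0
      · linear_combination (b ^ 2 * d - b ^ 3 * c) * h2 + (b ^ 2 * c - b * d) * h1
          + (d - b * c) * h0
      · linear_combination -(b ^ 3 * d + d ^ 2) * h2 + (b ^ 2 * d + c * d) * h1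
          - (b * d + c ^ 2) * h0
  · rintro (⟨z, hz, rfl⟩ | ⟨b, c, d, h, rfl⟩)
    · refine ⟨z, -z ^ 2, -z ^ 3, ne_zero_of_isRoot hR hd hA hz, ?_, rfl⟩
      rw [Polynomial.IsRoot, eval_of_monic_of_natDegree_eq_five hR hd] at hz
      refine ⟨?_, ?_, ?_⟩
      · linear_combination -hz
      · linear_combination -2 * z * hz
      · linear_combination - z ^ 2 * hz
    · refine ⟨b, c, d, ne_mul_and_ne_zero_of_cubic_dvd hR hd hA h |>.2, ?_, rfl⟩
      · obtain ⟨h2, h1, h0⟩ := (cubic_dvd_iff hR hd).1 h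
        rw [h2, h1, h0]
        refine ⟨?_, ?_, ?_⟩ <;> ring

theorem not_X_sq_add_C_dvd_of_map {K : Type*} [Field K] [Algebra k K] {R : Polynomial k}
    (hA : ∀ q : K, ¬ (.X ^ 2 + .C q : Polynomial K) ∣ R.map (algebraMap k K)) (q : k) :
    ¬ (.X ^ 2 + .C q : Polynomial k) ∣ R := fun h ↦ hA (algebraMap k K q) (by
  simpa using Polynomial.map_dvd (algebraMap k K) h)

theorem exists_mem_residualLine_ne_zero [CharZero k] {R : Polynomial k} (hR : R.Monic)
    (hd : R.natDegree = 5)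
    (hA : ∀ q : AlgebraicClosure k, ¬ (.X ^ 2 + .C q : Polynomial (AlgebraicClosure k)) ∣
      R.map (algebraMap k (AlgebraicClosure k))) {z : k} (hz : R.IsRoot z) :
    ∃ v ∈ residualLine R z, v 1 ≠ 0 := by
  by_contra! h
  have hm := h _ (Submodule.mem_span_pair.2 ⟨1, 0, rfl⟩)
  have hn := h _ (Submodule.mem_span_pair.2 ⟨0, -1, rfl⟩)
  simp only [Pi.add_apply, Pi.smul_apply, Matrix.cons_val, smul_eq_mul, one_mul, zero_mul,
    add_zero, zero_add, neg_one_mul, neg_neg] at hm hn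
  rw [Polynomial.IsRoot, eval_of_monic_of_natDegree_eq_five hR hd] at hz
  rw [hn, mul_zero, add_zero] at hm
  have h4 : R.coeff 4 = -z := by linear_combination hn
  have h2 : R.coeff 2 = -z * R.coeff 3 := by linear_combination hm
  have h0 : R.coeff 0 = -z * R.coeff 1 := by
    linear_combination hz - z ^ 4 * h4 - z ^ 2 * h2
  obtain ⟨s, hs⟩ := IsAlgClosed.exists_eq_mul_self (discrim (1 : AlgebraicClosure k)
    (algebraMap k _ (R.coeff 3)) (algebraMap k _ (R.coeff 1)))
  obtain ⟨w, hw⟩ := exists_quadratic_eq_zero one_ne_zero ⟨s, hs⟩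
  refine hA (-w) (X_sq_sub_C_dvd (hR.map _) (by rwa [hR.natDegree_map]) ?_ ?_)
  · simp only [Polynomial.coeff_map]
    linear_combination hw
  · simp only [Polynomial.coeff_map, h4, h2, h0, map_mul, map_neg]
    linear_combination -algebraMap k (AlgebraicClosure k) z * hw

theorem graphLine_ne_of_mem_baseLine {W : Submodule k (Fin 4 → k)} {v : Fin 4 → k} (hv : v ∈ W)
    (hv0 : v ≠ 0) (hvb : v ∈ baseLine k) (φ : Fin 4 → k) : graphLine φ ≠ W := by
  rintro rfl
  obtain ⟨h0, h1⟩ := mem_baseLine.1 hvb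
  obtain ⟨h2, h3⟩ := mem_graphLine.1 hv
  refine hv0 ?_
  ext i
  fin_cases i <;> simp [h0, h1, h2, h3]

theorem graphLine_injective : Function.Injective (graphLine (k := k)) := by
  intro φ ψ h
  have h0 : ![1, 0, φ 0, φ 2] ∈ graphLine ψ := h ▸ mem_graphLine.2 (by simp)
  have h1 : ![0, 1, φ 1, φ 3] ∈ graphLine ψ := h ▸ mem_graphLine.2 (by simp)
  rw [mem_graphLine] at h0 h1
  simp at h0 h1
  ext i
  fin_cases i <;> simp [h0, h1]

theorem mem_transversalLine_self (z : k) : ![z, 1, 0, 0] ∈ transversalLine z :=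
  mem_transversalLine.2 (by simp)

theorem transversalLine_injective : Function.Injective (transversalLine (k := k)) := by
  intro z z' h
  have := h ▸ mem_transversalLine_self z
  simpa using (mem_transversalLine.1 this).1

theorem setOf_isLineOn_quinticCubic [CharZero k] {R : Polynomial k} (hR : R.Monic)
    (hd : R.natDegree = 5) :
    {W : Submodule k (Fin 4 → k) | IsLineOn (quinticCubic R) W} =
      (({baseLine k} ∪ transversalLine '' {z | R.IsRoot z}) ∪
        residualLine R '' {z | R.IsRoot z}) ∪ graphLine '' graphMatrices R := by
  ext W
  simp only [Set.mem_ofPred_eq, isLineOn_iff, Set.mem_union, Set.mem_singleton_iff, Set.mem_image]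
  constructor
  · rintro ⟨hW, hF⟩
    rcases eq_graphLine_or_exists_mem_baseLine hW with ⟨φ, rfl⟩ | ⟨v, hv, hv0, hvb⟩
    · exact .inr ⟨φ, hF, rfl⟩
    · rcases eq_baseLine_or_of_mem_baseLine hR hd hW hF hv hv0 hvb with h | ⟨z, hz, h | h⟩
      · exact .inl (.inl (.inl h))
      · exact .inl (.inl (.inr ⟨z, hz, h.symm⟩))
      · exact .inl (.inr ⟨z, hz, h.symm⟩)
  · rintro (((rfl | ⟨z, hz, rfl⟩) | ⟨z, hz, rfl⟩) | ⟨φ, hφ, rfl⟩)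
    · refine ⟨finrank_baseLine, fun x hx ↦ ?_⟩
      obtain ⟨h0, h1⟩ := mem_baseLine.1 hx
      simp [eval_quinticCubic, h0, h1]
    · refine ⟨finrank_transversalLine z, fun x hx ↦ ?_⟩
      obtain ⟨h0, h1⟩ := mem_transversalLine.1 hx
      rw [eval_quinticCubic_of_root hR hd hz h0, h1]
      ring
    · refine ⟨finrank_residualLine R z, fun x hx ↦ ?_⟩
      obtain ⟨h0, h1⟩ := mem_residualLine.1 hx
      rw [eval_quinticCubic_of_root hR hd hz h0, sub_eq_zero.2 h1, mul_zero]
    · exact ⟨finrank_graphLine φ, hφ⟩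

theorem encard_graphMatrices [CharZero k] {R : Polynomial k} (hR : R.Monic)
    (hd : R.natDegree = 5) (hA : ∀ q : k, ¬ (.X ^ 2 + .C q : Polynomial k) ∣ R) :
    (graphMatrices R).encard = 1 + {z | R.IsRoot z}.encard +
      {g : Polynomial k | (g.Monic ∧ g.natDegree = 3) ∧ g ∣ R}.encard := by
  have hdvd {g : Polynomial k} (hg : (g.Monic ∧ g.natDegree = 3) ∧ g ∣ R) :
      (.X ^ 3 + .C (g.coeff 2) * .X ^ 2 + .C (g.coeff 1) * .X + .C (g.coeff 0) : Polynomial k)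
        ∣ R := by
    rw [← eq_of_monic_of_natDegree_eq_three hg.1.1 hg.1.2]
    exact hg.2
  have heq : graphMatrices R = ({0} ∪ (fun z ↦ cubicMatrix R z (-z ^ 2) (-z ^ 3)) ''
      {z | R.IsRoot z}) ∪ (fun g : Polynomial k ↦ cubicMatrix R (g.coeff 2) (g.coeff 1) (g.coeff 0))
        '' {g : Polynomial k | (g.Monic ∧ g.natDegree = 3) ∧ g ∣ R} := by
    ext φ
    rw [mem_graphMatrices_iff_root_or_cubic hR hd hA]
    simp only [Set.mem_union, Set.mem_singleton_iff, Set.mem_image, Set.mem_ofPred_eq, or_assoc]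
    refine or_congr_right (or_congr ⟨?_, ?_⟩ ⟨?_, ?_⟩)
    · rintro ⟨z, hz, rfl⟩
      exact ⟨z, hz, rfl⟩
    · rintro ⟨z, hz, rfl⟩
      exact ⟨z, hz, rfl⟩
    · rintro ⟨b, c, d, h, rfl⟩
      exact ⟨_, ⟨cubic_monic_natDegree b c d, h⟩, by simp [Polynomial.coeff_X, Polynomial.coeff_C]⟩
    · rintro ⟨g, hg, rfl⟩
      exact ⟨_, _, _, hdvd hg, rfl⟩
  have hne {b c d : k} (hK : c ^ 2 - R.coeff 3 * c + R.coeff 1 ≠ 0) :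
      0 ≠ cubicMatrix R b c d := by
    intro h
    simpa [cubicMatrix, hK] using (congrFun h 0).symm
  rw [heq, Set.encard_union_eq, Set.encard_union_eq, Set.encard_singleton, Set.InjOn.encard_image,
    Set.InjOn.encard_image]
  · intro g hg g' hg' h
    obtain ⟨h2, h1, h0⟩ := cubicMatrix_inj (ne_mul_and_ne_zero_of_cubic_dvd hR hd hA (hdvd hg)).2 h
    rw [eq_of_monic_of_natDegree_eq_three hg.1.1 hg.1.2,
      eq_of_monic_of_natDegree_eq_three hg'.1.1 hg'.1.2, h2, h1, h0]
  · intro z hz z' hz' h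
    exact (cubicMatrix_inj (ne_zero_of_isRoot hR hd hA hz) h).1
  · rw [Set.disjoint_singleton_left]
    rintro ⟨z, hz, h⟩
    exact hne (ne_zero_of_isRoot hR hd hA hz) h.symm
  · rw [Set.disjoint_left]
    rintro φ (rfl | ⟨z, hz, rfl⟩) ⟨g, hg, h⟩
    · exact hne (ne_mul_and_ne_zero_of_cubic_dvd hR hd hA (hdvd hg)).2 h.symm
    · have h' := ne_mul_and_ne_zero_of_cubic_dvd hR hd hA (hdvd hg)
      obtain ⟨h2, h1, h0⟩ := cubicMatrix_inj h'.2 h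
      refine h'.1 ?_
      rw [h2, h1, h0]
      ring

/-- The number of lines on the surface of `quinticCubic R`. -/
theorem encard_setOf_isLineOn_quinticCubic [CharZero k] {R : Polynomial k} (hR : R.Monic)
    (hd : R.natDegree = 5)
    (hA : ∀ q : AlgebraicClosure k, ¬ (.X ^ 2 + .C q : Polynomial (AlgebraicClosure k)) ∣
      R.map (algebraMap k (AlgebraicClosure k))) :
    {W : Submodule k (Fin 4 → k) | IsLineOn (quinticCubic R) W}.encard =
      2 + 3 * {z | R.IsRoot z}.encard +
        {g : Polynomial k | (g.Monic ∧ g.natDegree = 3) ∧ g ∣ R}.encard := by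
  rw [setOf_isLineOn_quinticCubic hR hd, Set.encard_union_eq, Set.encard_union_eq,
    Set.encard_union_eq, Set.encard_singleton, graphLine_injective.encard_image,
    transversalLine_injective.encard_image, Set.InjOn.encard_image,
    encard_graphMatrices hR hd (not_X_sq_add_C_dvd_of_map hA)]
  · ring
  · intro z hz z' hz' h
    obtain ⟨v, hv, hv1⟩ := exists_mem_residualLine_ne_zero hR hd hA hz
    exact mul_right_cancel₀ hv1 ((mem_residualLine.1 hv).1.symm.trans
      (mem_residualLine.1 (show v ∈ residualLine R z' from h ▸ hv)).1)
  · rw [Set.disjoint_singleton_left]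
    rintro ⟨z, hz, h⟩
    have := mem_transversalLine_self z
    rw [h, mem_baseLine] at this
    simp at this
  · rw [Set.disjoint_right]
    rintro W ⟨z, hz, rfl⟩ (h | ⟨z', hz', h⟩)
    · obtain ⟨v, hv, hv1⟩ := exists_mem_residualLine_ne_zero hR hd hA hz
      exact hv1 (mem_baseLine.1 (show v ∈ baseLine k from h ▸ hv)).2
    · have := mem_transversalLine_self z'
      rw [h, mem_residualLine] at this
      simp at this
  · rw [Set.disjoint_left]
    rintro W ((rfl | ⟨z, hz, rfl⟩) | ⟨z, hz, rfl⟩) ⟨φ, hφ, h⟩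
    · refine graphLine_ne_of_mem_baseLine (v := ![0, 0, 1, 0]) ?_ ?_ ?_ φ h <;> simp [mem_baseLine]
    · refine graphLine_ne_of_mem_baseLine (v := ![0, 0, 1, -z ^ 2]) ?_ ?_ ?_ φ h <;>
        simp [mem_baseLine, mem_transversalLine]
    · obtain ⟨w, hw, hw0, hw1⟩ := exists_mem_ne_zero_of_finrank_eq_two (finrank_residualLine R z)
        (LinearMap.proj 1)
      refine graphLine_ne_of_mem_baseLine hw hw0 (mem_baseLine.2 ⟨?_, hw1⟩) φ h
      rw [(mem_residualLine.1 hw).1, show w 1 = 0 from hw1, mul_zero]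

theorem eval_derivative_of_monic_of_natDegree_eq_five {R : Polynomial k} (hR : R.Monic)
    (hd : R.natDegree = 5) (z : k) :
    R.derivative.eval z = 5 * z ^ 4 + 4 * R.coeff 4 * z ^ 3 + 3 * R.coeff 3 * z ^ 2
      + 2 * R.coeff 2 * z + R.coeff 1 := by
  conv_lhs => rw [eq_of_monic_of_natDegree_eq_five hR hd]
  simp
  ring

/-- The singular points of the surface of `quinticCubic R` come from double roots of `R` and from
factors `X ^ 2 + q` of `R`. -/
theorem eq_zero_of_partials_quinticCubic [CharZero k] {R : Polynomial k} (hR : R.Monic)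
    (hd : R.natDegree = 5) (hsep : R.Separable)
    (hA : ∀ q : k, ¬ (.X ^ 2 + .C q : Polynomial k) ∣ R) {x : Fin 4 → k}
    (h0 : 2 * x 0 * x 2 + (R.coeff 1 * x 2 ^ 2 - R.coeff 3 * x 2 * x 3 + x 3 ^ 2) = 0)
    (h1 : 2 * x 1 * x 3 + (R.coeff 0 * x 2 ^ 2 - R.coeff 2 * x 2 * x 3
      + R.coeff 4 * x 3 ^ 2) = 0)
    (h2 : x 0 ^ 2 + x 0 * (2 * R.coeff 1 * x 2 - R.coeff 3 * x 3)
      + x 1 * (2 * R.coeff 0 * x 2 - R.coeff 2 * x 3) = 0)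
    (h3 : x 1 ^ 2 + x 0 * (-R.coeff 3 * x 2 + 2 * x 3)
      + x 1 * (-R.coeff 2 * x 2 + 2 * R.coeff 4 * x 3) = 0) : x = 0 := by
  have hA2 : x 0 ^ 2 * x 2 + x 1 ^ 2 * x 3 = 0 := by
    refine mul_left_cancel₀ (three_ne_zero (α := k)) ?_
    linear_combination 2 * x 0 * h0 + 2 * x 1 * h1 - x 2 * h2 - x 3 * h3
  by_cases hx : x 0 = 0 ∧ x 1 = 0
  · obtain ⟨hx0, hx1⟩ := hx
    simp only [hx0, hx1, mul_zero, zero_mul, zero_add] at h0 h1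
    by_cases hx2 : x 2 = 0
    · have hx3 : x 3 = 0 := by simpa [hx2] using h0
      ext i
      fin_cases i <;> assumption
    · obtain ⟨w, hw⟩ : ∃ w, x 3 = -w * x 2 := ⟨-x 3 / x 2, by field_simp⟩
      rw [hw] at h0 h1
      refine (hA (-w) (X_sq_sub_C_dvd hR hd (w := w) ?_ ?_)).elim <;>
        refine mul_left_cancel₀ (pow_ne_zero 2 hx2) ?_
      · linear_combination h0
      · linear_combination h1
  · obtain ⟨m, hm2, hm3⟩ : ∃ m, x 2 = m * x 1 ^ 2 ∧ x 3 = -m * x 0 ^ 2 := by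
      by_cases hx1 : x 1 = 0
      · have hx0 : x 0 ≠ 0 := fun h ↦ hx ⟨h, hx1⟩
        refine ⟨-x 3 / x 0 ^ 2, ?_, by field_simp⟩
        simpa [hx1, hx0] using hA2
      · refine ⟨x 2 / x 1 ^ 2, by field_simp, ?_⟩
        field_simp
        linear_combination hA2
    rw [hm2, hm3] at h0 h1 h2 h3
    have hm : m ≠ 0 := by
      rintro rfl
      refine hx ⟨?_, ?_⟩
      · simpa using h2
      · simpa using h3
    have hroot : x 0 ^ 5 + R.coeff 4 * x 0 ^ 4 * x 1 + R.coeff 3 * x 0 ^ 3 * x 1 ^ 2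
        + R.coeff 2 * x 0 ^ 2 * x 1 ^ 3 + R.coeff 1 * x 0 * x 1 ^ 4 + R.coeff 0 * x 1 ^ 5 = 0 := by
      refine mul_left_cancel₀ (pow_ne_zero 2 hm) ?_
      linear_combination x 0 * h0 + x 1 * h1
    have hx1 : x 1 ≠ 0 := by
      intro h
      simp only [h, not_and, not_true, imp_false] at hx
      simp [h, hx] at hroot
    obtain ⟨z, hz⟩ : ∃ z, x 0 = z * x 1 := ⟨x 0 / x 1, by field_simp⟩
    have hzR : R.eval z = 0 := by
      rw [eval_of_monic_of_natDegree_eq_five hR hd]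
      refine mul_left_cancel₀ (pow_ne_zero 5 hx1) ?_
      rw [hz] at hroot
      linear_combination hroot
    refine (hsep.eval₂_derivative_ne_zero (RingHom.id k) (x := z) hzR ?_).elim
    rw [← Polynomial.eval, eval_derivative_of_monic_of_natDegree_eq_five hR hd]
    refine mul_left_cancel₀ (mul_ne_zero (pow_ne_zero 2 hm) (pow_ne_zero 4 hx1)) ?_
    rw [hz] at h0 h3
    linear_combination h0 - 2 * m * z * x 1 * h3

theorem isSmoothCubic_quinticCubic [CharZero k] {R : Polynomial k} (hR : R.Monic)
    (hd : R.natDegree = 5) (hsep : R.Separable)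
    (hA : ∀ q : AlgebraicClosure k, ¬ (.X ^ 2 + .C q : Polynomial (AlgebraicClosure k)) ∣
      R.map (algebraMap k (AlgebraicClosure k))) : IsSmoothCubic k (quinticCubic R) := by
  refine ⟨quinticCubic_ne_zero R, quinticCubic_isHomogeneous R, fun x ⟨_, hx⟩ ↦ ?_⟩
  have h0 := hx 0
  have h1 := hx 1
  have h2 := hx 2
  have h3 := hx 3
  simp [quinticCubic, pderiv_X] at h0 h1 h2 h3
  have := algebraRat.charZero (AlgebraicClosure k)
  refine eq_zero_of_partials_quinticCubic (hR.map _) (by rwa [hR.natDegree_map]) hsep.map hA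
    ?_ ?_ ?_ ?_ <;> simp only [Polynomial.coeff_map]
  · linear_combination h0
  · linear_combination h1
  · linear_combination h2
  · linear_combination h3

/-- After a translation, a polynomial over an infinite field has no factor `X ^ 2 + q` over any
extension field of characteristic zero. -/
theorem exists_forall_not_X_sq_add_C_dvd_taylor [CharZero k] (K : Type*) [Field K] [IsAlgClosed K]
    [Algebra k K] {R : Polynomial k} (hR : R ≠ 0) :
    ∃ c : k, ∀ q : K, ¬ (.X ^ 2 + .C q : Polynomial K) ∣
      (Polynomial.taylor c R).map (algebraMap k K) := by
  have hR' : R.map (algebraMap k K) ≠ 0 := by rwa [Ne, Polynomial.map_eq_zero]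
  have hfin : {z | (R.map (algebraMap k K)).IsRoot z}.Finite :=
    Polynomial.finite_setOfPred_isRoot hR'
  have hinj : Function.Injective fun c : k ↦ algebraMap k K (2 * c) :=
    (algebraMap k K).injective.comp (mul_right_injective₀ two_ne_zero)
  obtain ⟨c, hc⟩ := ((hfin.add hfin).preimage hinj.injOn).exists_notMem
  refine ⟨c, fun q hq ↦ hc ?_⟩
  obtain ⟨w, hw⟩ := IsAlgClosed.exists_eq_mul_self (-q)
  have hroot (s : K) (hs : s * s = -q) :
      (R.map (algebraMap k K)).IsRoot (s + algebraMap k K c) := by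
    rw [Polynomial.map_taylor] at hq
    rw [Polynomial.IsRoot, ← Polynomial.taylor_eval]
    refine Polynomial.eval_eq_zero_of_dvd_of_eval_eq_zero hq ?_
    simp [pow_two, hs]
  refine ⟨_, hroot w hw.symm, _, hroot (-w) (by rw [neg_mul_neg, hw]), ?_⟩
  simp only [map_mul, map_ofNat]
  ring

theorem encard_isRoot_taylor (R : Polynomial k) (c : k) :
    {z | (Polynomial.taylor c R).IsRoot z}.encard = {z | R.IsRoot z}.encard := by
  simp only [Polynomial.IsRoot, Polynomial.taylor_eval]
  exact Set.encard_preimage_of_bijective (Equiv.addRight c).bijective {z | R.eval z = 0}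

theorem encard_dvd_taylor (R : Polynomial k) (c : k) (n : ℕ) :
    {g : Polynomial k | (g.Monic ∧ g.natDegree = n) ∧ g ∣ Polynomial.taylor c R}.encard =
      {g : Polynomial k | (g.Monic ∧ g.natDegree = n) ∧ g ∣ R}.encard := by
  rw [← Set.encard_preimage_of_bijective (Polynomial.taylorEquiv c).bijective]
  congr 1
  ext g
  have hdvd : Polynomial.taylor c g ∣ Polynomial.taylor c R ↔ g ∣ R :=
    map_dvd_iff (Polynomial.taylorEquiv c)
  change ((Polynomial.taylor c g).Monic ∧ (Polynomial.taylor c g).natDegree = n) ∧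
    Polynomial.taylor c g ∣ Polynomial.taylor c R ↔ _
  rw [Polynomial.Monic, Polynomial.leadingCoeff_taylor, Polynomial.natDegree_taylor, hdvd]
  rfl

theorem separable_taylor {R : Polynomial k} (h : R.Separable) (c : k) :
    (Polynomial.taylor c R).Separable := by
  have := IsCoprime.map h (Polynomial.taylorAlgHom c).toRingHom
  have hder : (Polynomial.taylor c R).derivative = Polynomial.taylor c R.derivative := by
    simp [Polynomial.taylor_apply, Polynomial.derivative_comp]
  rw [Polynomial.Separable, hder]
  exact this

/-- A separable monic quintic yields a smooth cubic surface whose lines are counted by the roots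
and the monic cubic factors. -/
theorem exists_isSmoothCubic_encard_eq_of_separable [CharZero k] {R : Polynomial k}
    (hR : R.Monic) (hd : R.natDegree = 5) (hsep : R.Separable) :
    ∃ f : MvPolynomial (Fin 4) k, IsSmoothCubic k f ∧
      {W : Submodule k (Fin 4 → k) | IsLineOn f W}.encard = 2 + 3 * {z | R.IsRoot z}.encard +
        {g : Polynomial k | (g.Monic ∧ g.natDegree = 3) ∧ g ∣ R}.encard := by
  obtain ⟨c, hc⟩ := exists_forall_not_X_sq_add_C_dvd_taylor (AlgebraicClosure k) hR.ne_zero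
  have hm : (Polynomial.taylor c R).Monic := by
    rwa [Polynomial.Monic, Polynomial.leadingCoeff_taylor]
  have hd' : (Polynomial.taylor c R).natDegree = 5 := by rwa [Polynomial.natDegree_taylor]
  refine ⟨_, isSmoothCubic_quinticCubic hm hd' (separable_taylor hsep c) hc, ?_⟩
  rw [encard_setOf_isLineOn_quinticCubic hm hd' hc, encard_isRoot_taylor, encard_dvd_taylor]

theorem encard_setOf_isRoot (R : Polynomial k) :
    {z | R.IsRoot z}.encard =
      {g : Polynomial k | (g.Monic ∧ g.natDegree = 1) ∧ g ∣ R}.encard := by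
  have hinj : Function.Injective fun z : k ↦ (.X - .C z : Polynomial k) := fun z z' h ↦
    Polynomial.C_injective (sub_right_injective h)
  rw [← hinj.encard_image]
  congr 1
  ext g
  constructor
  · rintro ⟨z, hz, rfl⟩
    exact ⟨⟨Polynomial.monic_X_sub_C z, Polynomial.natDegree_X_sub_C z⟩,
      Polynomial.dvd_iff_isRoot.2 hz⟩
  · rintro ⟨⟨hg, hg1⟩, hdvd⟩
    have heq : .X - .C (-g.coeff 0) = g := by
      rw [map_neg, sub_neg_eq_add]
      exact (Polynomial.Monic.eq_X_add_C hg hg1).symm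
    exact ⟨-g.coeff 0, Polynomial.dvd_iff_isRoot.1 (heq.symm ▸ hdvd), heq⟩

section Divisors

variable {ι : Type*} {p : ι → Polynomial k}

theorem exists_eq_prod_of_monic_of_dvd_prod (hm : ∀ i, (p i).Monic) (hp : ∀ i, Irreducible (p i))
    (s : Finset ι) {g : Polynomial k} (hg : g.Monic) (h : g ∣ ∏ i ∈ s, p i) :
    ∃ t ⊆ s, g = ∏ i ∈ t, p i := by
  classical
  induction s using Finset.induction_on generalizing g with
  | empty => exact ⟨∅, subset_rfl, hg.eq_one_of_isUnit (isUnit_of_dvd_one (by simpa using h))⟩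
  | insert a s ha ih =>
    rw [Finset.prod_insert ha] at h
    by_cases hag : p a ∣ g
    · obtain ⟨g', rfl⟩ := hag
      obtain ⟨t, hts, rfl⟩ := ih ((hm a).of_mul_monic_left hg)
        ((mul_dvd_mul_iff_left (hm a).ne_zero).1 h)
      refine ⟨insert a t, Finset.insert_subset_insert a hts, ?_⟩
      rw [Finset.prod_insert fun hat ↦ ha (hts hat)]
    · obtain ⟨t, hts, rfl⟩ := ih hg
        (((hp a).coprime_iff_not_dvd.2 hag).symm.dvd_of_dvd_mul_left h)
      exact ⟨t, hts.trans (Finset.subset_insert a s), rfl⟩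

theorem prod_injective_of_irreducible (hm : ∀ i, (p i).Monic) (hp : ∀ i, Irreducible (p i))
    (hinj : Function.Injective p) : Function.Injective fun t : Finset ι ↦ ∏ i ∈ t, p i := by
  have hsub {t u : Finset ι} (h : ∏ i ∈ t, p i = ∏ i ∈ u, p i) : t ⊆ u := fun i hi ↦ by
    obtain ⟨j, hj, hij⟩ := (hp i).prime.exists_mem_finset_dvd (h ▸ Finset.dvd_prod_of_mem p hi)
    rwa [hinj (Polynomial.eq_of_monic_of_associated (hm i) (hm j)
      ((hp i).associated_of_dvd (hp j) hij))]
  exact fun t u h ↦ (hsub h).antisymm (hsub h.symm)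

theorem encard_monic_dvd_prod [Fintype ι] [DecidableEq ι] (hm : ∀ i, (p i).Monic)
    (hp : ∀ i, Irreducible (p i)) (hinj : Function.Injective p) (n : ℕ) :
    {g : Polynomial k | (g.Monic ∧ g.natDegree = n) ∧ g ∣ ∏ i, p i}.encard =
      (Finset.univ.filter fun t : Finset ι ↦ ∑ i ∈ t, (p i).natDegree = n).card := by
  rw [← Set.encard_coe_eq_coe_finsetCard,
    ← (prod_injective_of_irreducible hm hp hinj).encard_image]
  congr 1
  ext g
  have hprod (t : Finset ι) : (∏ i ∈ t, p i).Monic :=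
    Polynomial.monic_prod_of_monic _ _ fun i _ ↦ hm i
  have hdeg (t : Finset ι) : (∏ i ∈ t, p i).natDegree = ∑ i ∈ t, (p i).natDegree :=
    Polynomial.natDegree_prod_of_monic _ _ fun i _ ↦ hm i
  simp only [Finset.coe_filter, Finset.mem_univ, true_and, Set.mem_image, Set.mem_ofPred_eq]
  constructor
  · rintro ⟨⟨hg, hn⟩, h⟩
    obtain ⟨t, -, rfl⟩ := exists_eq_prod_of_monic_of_dvd_prod hm hp _ hg h
    exact ⟨t, by rw [← hdeg, hn], rfl⟩
  · rintro ⟨t, ht, rfl⟩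
    exact ⟨⟨hprod t, by rw [hdeg, ht]⟩, Finset.prod_dvd_prod_of_subset _ _ _ (Finset.subset_univ t)⟩

/-- Prescribing the degrees of the irreducible factors of the quintic prescribes the number of
lines. -/
theorem exists_isSmoothCubic_encard_eq_of_irreducible [CharZero k] [Fintype ι] [DecidableEq ι]
    (hm : ∀ i, (p i).Monic) (hp : ∀ i, Irreducible (p i)) (hinj : Function.Injective p)
    (d : ι → ℕ) (hd : ∀ i, (p i).natDegree = d i) (h5 : ∑ i, d i = 5) :
    ∃ f : MvPolynomial (Fin 4) k, IsSmoothCubic k f ∧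
      {W : Submodule k (Fin 4 → k) | IsLineOn f W}.encard =
        ((2 + 3 * (Finset.univ.filter fun t : Finset ι ↦ ∑ i ∈ t, d i = 1).card +
          (Finset.univ.filter fun t : Finset ι ↦ ∑ i ∈ t, d i = 3).card : ℕ) : ℕ∞) := by
  have hsep : (∏ i, p i).Separable := by
    refine Polynomial.separable_prod (fun i j hij ↦ ?_) fun i ↦ (hp i).separable
    refine (hp i).coprime_iff_not_dvd.2 fun h ↦ hij (hinj ?_)
    exact Polynomial.eq_of_monic_of_associated (hm i) (hm j) ((hp i).associated_of_dvd (hp j) h)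
  obtain ⟨f, hf, hcard⟩ := exists_isSmoothCubic_encard_eq_of_separable
    (Polynomial.monic_prod_of_monic _ _ fun i _ ↦ hm i)
    (by rw [Polynomial.natDegree_prod_of_monic _ _ fun i _ ↦ hm i]; simpa only [hd]) hsep
  refine ⟨f, hf, hcard.trans ?_⟩
  rw [encard_setOf_isRoot, encard_monic_dvd_prod hm hp hinj, encard_monic_dvd_prod hm hp hinj]
  simp only [hd]
  push_cast
  rfl

end Divisors
end QuinticCubic

section Uniformizer

open IsDedekindDomain WithZero

theorem exists_intValuation_eq_exp_neg_one (k : Type*) [Field k] [NumberField k] :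
    ∃ (v : HeightOneSpectrum (NumberField.RingOfIntegers k)) (a : NumberField.RingOfIntegers k),
      v.intValuation a = exp (-1 : ℤ) := by
  obtain ⟨P, hP, hprime⟩ :=
    Ring.not_isField_iff_exists_prime.1 (NumberField.RingOfIntegers.not_isField k)
  exact ⟨⟨P, hprime, hP⟩, HeightOneSpectrum.intValuation_exists_uniformizer _⟩

variable {A : Type*} [CommRing A] [IsDedekindDomain A] (K : Type*) [Field K] [Algebra A K]
  [IsFractionRing A K] {v : HeightOneSpectrum A} {a : A}

theorem irreducible_X_pow_sub_C_of_intValuation (ha : v.intValuation a = exp (-1 : ℤ)) {n : ℕ}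
    (hn : n ≠ 0) : Irreducible (.X ^ n - .C (algebraMap A K a) : Polynomial K) := by
  have hmem : a ∈ v.asIdeal := by
    rw [← v.intValuation_lt_one_iff_mem, ha, ← exp_zero, exp_lt_exp]
    norm_num
  have hnot : a ∉ v.asIdeal ^ 2 := by
    rw [← v.intValuation_le_pow_iff_mem, ha, exp_le_exp]
    norm_num
  have hm := Polynomial.monic_X_pow_sub_C a hn
  have hirr : Irreducible (.X ^ n - .C a : Polynomial A) := by
    refine Polynomial.irreducible_of_eisenstein_criterion v.isPrime ?_ (fun i hi ↦ ?_) ?_ ?_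
      hm.isPrimitive
    · rw [hm.leadingCoeff]
      exact fun h ↦ v.isPrime.ne_top ((Ideal.eq_top_iff_one _).2 h)
    · rw [Polynomial.degree_X_pow_sub_C (Nat.pos_of_ne_zero hn), Nat.cast_lt] at hi
      rw [Polynomial.coeff_sub, Polynomial.coeff_X_pow, if_neg hi.ne, Polynomial.coeff_C]
      split_ifs <;> simp [hmem]
    · rw [Polynomial.degree_X_pow_sub_C (Nat.pos_of_ne_zero hn)]
      exact_mod_cast Nat.pos_of_ne_zero hn
    · simpa [Polynomial.coeff_X_pow, hn.symm] using hnot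
  have := (Polynomial.Monic.irreducible_iff_irreducible_map_fraction_map (K := K) hm).1 hirr
  simpa using this

theorem intValuation_mul_one_sub (ha : v.intValuation a = exp (-1 : ℤ)) :
    v.intValuation (a * (1 - a)) = exp (-1 : ℤ) := by
  rw [map_mul, Valuation.map_one_sub_of_lt, ha, mul_one]
  rw [ha, ← exp_zero, exp_lt_exp]
  norm_num

/-- An element of valuation one is not a square in the fraction field. -/
theorem sq_ne_of_intValuation (ha : v.intValuation a = exp (-1 : ℤ)) (x : K) :
    x ^ 2 ≠ algebraMap A K a := by
  intro h
  have := congrArg (fun y ↦ log (v.valuation K y)) h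
  simp only [map_pow, v.valuation_of_algebraMap, ha, log_pow, log_exp, nsmul_eq_mul] at this
  push_cast at this
  omega

theorem eq_zero_of_cube_add_cube (ha : v.intValuation a = exp (-1 : ℤ)) {x y z : K}
    (h : x ^ 3 + algebraMap A K a * y ^ 3 + algebraMap A K a ^ 2 * z ^ 3 = 0) :
    x = 0 ∧ y = 0 ∧ z = 0 := by
  have hva : v.valuation K (algebraMap A K a) = exp (-1 : ℤ) := by
    rw [v.valuation_of_algebraMap, ha]
  generalize algebraMap A K a = b at h hva
  have hb : b ≠ 0 := by
    rintro rfl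
    exact exp_ne_zero (hva.symm.trans (map_zero _))
  have key (i j : ℕ) (hij : ¬ (3 : ℤ) ∣ i - j) (x y : K)
      (hxy : v.valuation K (b ^ i * x ^ 3) = v.valuation K (b ^ j * y ^ 3)) : x = 0 ∧ y = 0 := by
    simp only [map_mul, map_pow, hva] at hxy
    by_cases hx : x = 0
    · simpa [hx] using hxy.symm
    by_cases hy : y = 0
    · simpa [hy] using hxy
    have hlog := congrArg log hxy
    rw [log_mul (by simp) (by simp [hx]), log_mul (by simp) (by simp [hy])] at hlog
    simp only [log_pow, log_exp, nsmul_eq_mul] at hlog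
    push_cast at hlog
    omega
  have hneg : x ^ 3 + b * y ^ 3 = -(b ^ 2 * z ^ 3) := by linear_combination h
  by_cases hxy : v.valuation K (x ^ 3) = v.valuation K (b * y ^ 3)
  · obtain ⟨rfl, rfl⟩ := key 0 1 (by norm_num) x y (by simpa using hxy)
    simpa [hb] using h
  · have hmax := Valuation.map_add_of_distinct_val _ hxy
    rw [hneg, Valuation.map_neg] at hmax
    rcases max_choice (v.valuation K (x ^ 3)) (v.valuation K (b * y ^ 3)) with hc | hc <;>
      rw [hc] at hmax
    · obtain ⟨rfl, rfl⟩ := key 2 0 (by norm_num) z x (by simpa using hmax)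
      simpa [hb] using h
    · obtain ⟨rfl, rfl⟩ := key 2 1 (by norm_num) z y (by simpa using hmax)
      simpa using h

end Uniformizer

section SpecialSurfaces

variable {k : Type*} [Field k]

/-- A diagonal cubic surface whose section by `x₃ = 0` has no `k`-points contains no `k`-line. -/
theorem exists_isSmoothCubic_setOf_isLineOn_eq_empty [CharZero k] {a : k} (ha0 : a ≠ 0)
    (ha : ∀ x y z : k, x ^ 3 + a * y ^ 3 + a ^ 2 * z ^ 3 = 0 → x = 0 ∧ y = 0 ∧ z = 0) :
    ∃ f : MvPolynomial (Fin 4) k, IsSmoothCubic k f ∧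
      {W : Submodule k (Fin 4 → k) | IsLineOn f W} = ∅ := by
  have hX (i : Fin 4) : (X i ^ 3 : MvPolynomial (Fin 4) k).IsHomogeneous 3 :=
    (isHomogeneous_X k i).pow 3
  refine ⟨X 0 ^ 3 + C a * X 1 ^ 3 + C (a ^ 2) * X 2 ^ 3 + X 3 ^ 3, ⟨?_, ?_, ?_⟩, ?_⟩
  · intro h
    simpa using congrArg (eval ![1, 0, 0, 0]) h
  · exact (((hX 0).add ((hX 1).C_mul a)).add ((hX 2).C_mul _)).add (hX 3)
  · rintro x ⟨-, hx⟩
    have h0 := hx 0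
    have h1 := hx 1
    have h2 := hx 2
    have h3 := hx 3
    have := algebraRat.charZero (AlgebraicClosure k)
    simp [pderiv_X, ha0] at h0 h1 h2 h3
    ext i
    fin_cases i <;> assumption
  · refine Set.eq_empty_of_forall_notMem fun W hW ↦ ?_
    obtain ⟨hW, hF⟩ := (isLineOn_iff _ W).1 hW
    obtain ⟨w, hw, hw0, hw3⟩ := exists_mem_ne_zero_of_finrank_eq_two hW (LinearMap.proj 3)
    have hw3 : w 3 = 0 := hw3
    have := hF w hw
    simp only [map_add, map_mul, map_pow, eval_X, eval_C, hw3] at this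
    obtain ⟨h0, h1, h2⟩ := ha (w 0) (w 1) (w 2) (by linear_combination this)
    refine hw0 ?_
    ext i
    fin_cases i <;> assumption

/-- The partial derivatives of
`(x₀ + x₃) x₁² - a x₀ x₂² + x₃ (x₀² - a x₃²)` have no nonzero common zero. -/
theorem eq_zero_of_partials_eq_zero {K : Type*} [Field K] [CharZero K] {a x₀ x₁ x₂ x₃ : K}
    (ha0 : a ≠ 0) (ha1 : a ≠ 1) (h0 : x₁ ^ 2 - a * x₂ ^ 2 + 2 * x₀ * x₃ = 0)
    (h1 : (x₀ + x₃) * x₁ = 0) (h2 : x₀ * x₂ = 0) (h3 : x₁ ^ 2 + x₀ ^ 2 - 3 * a * x₃ ^ 2 = 0) :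
    x₀ = 0 ∧ x₁ = 0 ∧ x₂ = 0 ∧ x₃ = 0 := by
  have h03 : x₀ = 0 → x₁ = 0 → x₀ = 0 ∧ x₁ = 0 ∧ x₂ = 0 ∧ x₃ = 0 := by
    rintro rfl rfl
    simp_all
  rcases mul_eq_zero.1 h2 with rfl | rfl
  · refine h03 rfl ?_
    rcases mul_eq_zero.1 h1 with h | h
    · rw [zero_add] at h
      subst h
      simpa using h3
    · exact h
  · rcases mul_eq_zero.1 h1 with h | rfl
    · obtain rfl : x₀ = -x₃ := by linear_combination h
      have : 3 * (1 - a) * x₃ ^ 2 = 0 := by linear_combination h3 - h0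
      have : x₃ = 0 := by simpa [sub_eq_zero, ha1.symm] using this
      subst this
      simpa using h0
    · refine h03 ?_ rfl
      by_contra hx
      have : x₃ = 0 := by simpa [hx] using h0
      subst this
      exact hx (by simpa using h3)

theorem eq_zero_of_sq_eq_mul_sq {a x y : k} (ha : ∀ x : k, x ^ 2 ≠ a) (h : x ^ 2 = a * y ^ 2) :
    x = 0 ∧ y = 0 := by
  have hy : y = 0 := by
    by_contra hy
    refine ha (x / y) ?_
    field_simp
    linear_combination h
  subst hy
  exact ⟨by simpa using h, rfl⟩

/-- The conditions that make `x₃ = 1` impossible on a line meeting `x₀ = x₃ = 0`. -/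
theorem eq_zero_of_line_conditions {a c d v₁ v₂ w₁ w₂ : k} (ha : ∀ x : k, x ^ 2 ≠ a)
    (ha' : ∀ x : k, x ^ 2 ≠ a * (a - 1)) (hw : ¬(w₁ = 0 ∧ w₂ = 0))
    (hP : (c + d) * w₁ ^ 2 = a * c * w₂ ^ 2) (hQ : (c + d) * v₁ * w₁ = a * c * v₂ * w₂)
    (hR : (c + d) * v₁ ^ 2 - a * c * v₂ ^ 2 + d * (c ^ 2 - a * d ^ 2) = 0) : d = 0 := by
  by_contra hd
  have ha0 : a ≠ 0 := fun h ↦ ha 0 (by simp [h])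
  rcases eq_or_ne c 0 with rfl | hc
  · refine hd (eq_zero_of_sq_eq_mul_sq (x := v₁) ha (mul_left_cancel₀ hd ?_)).2
    linear_combination hR
  rcases eq_or_ne (c + d) 0 with he | he
  · obtain rfl : c = -d := by linear_combination he
    refine ha' (a * v₂ / d) ?_
    field_simp
    refine mul_left_cancel₀ hd ?_
    linear_combination hR
  · have hw₂ : w₂ ≠ 0 := by
      rintro rfl
      exact hw ⟨by simpa [he] using hP, rfl⟩
    have hw₁ : w₁ ≠ 0 := by
      rintro rfl
      exact hw ⟨rfl, by simpa [ha0, hc] using hP.symm⟩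
    have hD : w₂ * v₁ - v₂ * w₁ = 0 := by
      refine (mul_eq_zero.1 (?_ : a * c * w₂ * _ = 0)).resolve_left (by simp [ha0, hc, hw₂])
      linear_combination w₁ * hQ - v₁ * hP
    have hV : (c + d) * v₁ ^ 2 - a * c * v₂ ^ 2 = 0 := by
      refine (mul_eq_zero.1 (?_ : w₁ ^ 2 * _ = 0)).resolve_left (by simp [hw₁])
      linear_combination v₁ ^ 2 * hP + a * c * (w₂ * v₁ + v₂ * w₁) * hD
    refine hd (eq_zero_of_sq_eq_mul_sq (x := c) ha (mul_left_cancel₀ hd ?_)).2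
    linear_combination hR - hV

/-- A smooth cubic surface whose only `k`-line is `x₀ = x₃ = 0`. -/
theorem exists_isSmoothCubic_setOf_isLineOn_eq_singleton [CharZero k] {a : k}
    (ha : ∀ x : k, x ^ 2 ≠ a) (ha' : ∀ x : k, x ^ 2 ≠ a * (a - 1)) :
    ∃ f : MvPolynomial (Fin 4) k, IsSmoothCubic k f ∧
      ∃ W, {W : Submodule k (Fin 4 → k) | IsLineOn f W} = {W} := by
  have hX (i : Fin 4) : (X i : MvPolynomial (Fin 4) k).IsHomogeneous 1 := isHomogeneous_X k i
  have ha0 : a ≠ 0 := fun h ↦ ha 0 (by simp [h])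
  have ha1 : a ≠ 1 := fun h ↦ ha 1 (by simp [h])
  refine ⟨(X 0 + X 3) * X 1 ^ 2 - C a * X 0 * X 2 ^ 2 + X 3 * (X 0 ^ 2 - C a * X 3 ^ 2),
    ⟨?_, ?_, ?_⟩, Submodule.span k {![0, 1, 0, 0], ![0, 0, 1, 0]}, ?_⟩
  · intro h
    simpa using congrArg (eval ![1, 1, 0, 0]) h
  · refine IsHomogeneous.add (IsHomogeneous.sub ?_ ?_) ?_
    · exact ((hX 0).add (hX 3)).mul ((hX 1).pow 2)
    · exact ((hX 0).C_mul a).mul ((hX 2).pow 2)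
    · exact (hX 3).mul (((hX 0).pow 2).sub (((hX 3).pow 2).C_mul a))
  · rintro x ⟨-, hx⟩
    have h0 := hx 0
    have h1 := hx 1
    have h2 := hx 2
    have h3 := hx 3
    have := algebraRat.charZero (AlgebraicClosure k)
    simp [pderiv_X, ha0] at h0 h1 h2 h3
    obtain ⟨e0, e1, e2, e3⟩ := eq_zero_of_partials_eq_zero (x₀ := x 0) (x₁ := x 1) (x₂ := x 2)
      (x₃ := x 3) (a := algebraMap k (AlgebraicClosure k) a) (by simpa using ha0)
      (by simpa using ha1) (by linear_combination h0) (mul_eq_zero.2 h1) (mul_eq_zero.2 h2)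
      (by linear_combination h3)
    ext i
    fin_cases i <;> assumption
  · ext W
    simp only [Set.mem_ofPred_eq, Set.mem_singleton_iff]
    have hL : Module.finrank k (Submodule.span k {![0, 1, 0, 0], ![0, 0, 1, 0]} :
        Submodule k (Fin 4 → k)) = 2 :=
      finrank_span_pair_of_linearIndependent
        (linearIndependent_pair_of_coords (i := 1) (j := 2) rfl rfl rfl)
    have hmem (x : Fin 4 → k) (h0 : x 0 = 0) (h3 : x 3 = 0) :
        x ∈ Submodule.span k {![0, 1, 0, 0], (![0, 0, 1, 0] : Fin 4 → k)} := by
      refine Submodule.mem_span_pair.2 ⟨x 1, x 2, ?_⟩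
      ext i
      fin_cases i <;> simp [h0, h3]
    constructor
    · intro hW
      obtain ⟨hW, hF⟩ := (isLineOn_iff _ W).1 hW
      simp only [map_add, map_sub, map_mul, map_pow, eval_X, eval_C] at hF
      obtain ⟨w, hw, hw0, hw3⟩ := exists_mem_ne_zero_of_finrank_eq_two hW (LinearMap.proj 3)
      obtain ⟨v, hv, hvw⟩ := exists_mem_linearIndependent_of_finrank_eq_two hW hw0
      have hw3 : w 3 = 0 := hw3
      have hline (t : k) := hF (v + t • w) (add_mem hv (W.smul_mem t hw))
      have hFw := hF w hw
      simp only [Pi.add_apply, Pi.smul_apply, smul_eq_mul, hw3] at hline hFw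
      by_cases hw12 : w 1 = 0 ∧ w 2 = 0
      · obtain ⟨hw1, hw2⟩ := hw12
        have hw00 : w 0 ≠ 0 := by
          intro h
          refine hw0 ?_
          ext i
          fin_cases i <;> assumption
        simp only [hw1, hw2] at hline
        obtain ⟨hA, hB, hC⟩ := quadratic_coeffs_eq_zero
          (a := (v 0 + v 3) * v 1 ^ 2 - a * v 0 * v 2 ^ 2 + v 3 * (v 0 ^ 2 - a * v 3 ^ 2))
          (b := w 0 * (v 1 ^ 2 - a * v 2 ^ 2 + 2 * v 0 * v 3)) (c := v 3 * w 0 ^ 2)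
          fun t ↦ by linear_combination hline t
        have hv3 : v 3 = 0 := by simpa [hw00] using hC
        have hB' := (mul_eq_zero.1 hB).resolve_left hw00
        obtain ⟨hv1, hv2⟩ := eq_zero_of_sq_eq_mul_sq (x := v 1) (y := v 2) ha
          (by rw [hv3] at hB'; linear_combination hB')
        have := LinearIndependent.pair_iff.1 hvw (v 0) (-w 0) (by
          ext i
          fin_cases i <;> simp [hv1, hv2, hv3, hw1, hw2, hw3]
          ring)
        exact absurd this.2 (by simpa using hw00)
      · have hw00 : w 0 = 0 := by
          by_contra h
          exact hw12 (eq_zero_of_sq_eq_mul_sq ha (mul_left_cancel₀ h (by linear_combination hFw)))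
        simp only [hw00] at hline
        obtain ⟨hA, hB, hC⟩ := quadratic_coeffs_eq_zero
          (a := (v 0 + v 3) * v 1 ^ 2 - a * v 0 * v 2 ^ 2 + v 3 * (v 0 ^ 2 - a * v 3 ^ 2))
          (b := 2 * ((v 0 + v 3) * v 1 * w 1 - a * v 0 * v 2 * w 2))
          (c := (v 0 + v 3) * w 1 ^ 2 - a * v 0 * w 2 ^ 2)
          fun t ↦ by linear_combination hline t
        have hv3 : v 3 = 0 := eq_zero_of_line_conditions ha ha' hw12 (sub_eq_zero.1 hC)
          (sub_eq_zero.1 (by simpa using hB)) hA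
        have hv0 : v 0 = 0 := by
          by_contra h
          exact hw12 (eq_zero_of_sq_eq_mul_sq ha (mul_left_cancel₀ h
            (by rw [hv3] at hC; linear_combination hC)))
        rw [← span_pair_eq_of_finrank_eq_two hW hw hv hvw]
        refine eq_of_le_of_finrank_eq_two (finrank_span_pair_of_linearIndependent hvw) hL ?_
        rw [Submodule.span_le]
        rintro x (rfl | rfl)
        · exact hmem _ hw00 hw3
        · exact hmem _ hv0 hv3
    · rintro rfl
      refine (isLineOn_iff _ _).2 ⟨hL, fun x hx ↦ ?_⟩
      obtain ⟨s, t, rfl⟩ := Submodule.mem_span_pair.1 hx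
      simp

end SpecialSurfaces

section LineCount

variable {k : Type*} [Field k]

/-- Realization of a line count by a squarefree quintic whose irreducible factors have
degrees `d`. -/
theorem exists_isSmoothCubic_ncard_eq [CharZero k] {m n : ℕ} (p : Fin m → Polynomial k)
    (d : Fin m → ℕ) (hp : ∀ i, (p i).Monic ∧ Irreducible (p i) ∧ (p i).natDegree = d i)
    (hinj : Function.Injective p) (h5 : ∑ i, d i = 5)
    (hn : 2 + 3 * (Finset.univ.filter fun t : Finset (Fin m) ↦ ∑ i ∈ t, d i = 1).card +
      (Finset.univ.filter fun t : Finset (Fin m) ↦ ∑ i ∈ t, d i = 3).card = n) :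
    ∃ f : MvPolynomial (Fin 4) k, IsSmoothCubic k f ∧
      {W : Submodule k (Fin 4 → k) | IsLineOn f W}.Finite ∧
      {W : Submodule k (Fin 4 → k) | IsLineOn f W}.ncard = n := by
  obtain ⟨f, hf, hcard⟩ := exists_isSmoothCubic_encard_eq_of_irreducible
    (fun i ↦ (hp i).1) (fun i ↦ (hp i).2.1) hinj d (fun i ↦ (hp i).2.2) h5
  rw [hn] at hcard
  exact ⟨f, hf, Set.finite_of_encard_eq_coe hcard, by simp [Set.ncard, hcard]⟩

theorem monic_irreducible_natDegree_X_sub_C (c : k) :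
    (.X - .C c : Polynomial k).Monic ∧ Irreducible (.X - .C c : Polynomial k) ∧
      (.X - .C c : Polynomial k).natDegree = 1 :=
  ⟨Polynomial.monic_X_sub_C c, Polynomial.irreducible_X_sub_C c, Polynomial.natDegree_X_sub_C c⟩

theorem monic_irreducible_natDegree_X_pow_sub_C {A : Type*} [CommRing A] [IsDedekindDomain A]
    [Algebra A k] [IsFractionRing A k] {v : IsDedekindDomain.HeightOneSpectrum A} {a : A}
    (ha : v.intValuation a = WithZero.exp (-1 : ℤ)) {n : ℕ} (hn : n ≠ 0) :
    (.X ^ n - .C (algebraMap A k a) : Polynomial k).Monic ∧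
      Irreducible (.X ^ n - .C (algebraMap A k a) : Polynomial k) ∧
      (.X ^ n - .C (algebraMap A k a) : Polynomial k).natDegree = n :=
  ⟨Polynomial.monic_X_pow_sub_C _ hn, irreducible_X_pow_sub_C_of_intValuation k ha hn,
    Polynomial.natDegree_X_pow_sub_C⟩

theorem X_sub_C_injective : Function.Injective fun c : k ↦ (.X - .C c : Polynomial k) :=
  fun _ _ h ↦ Polynomial.C_injective (sub_right_injective h)

theorem injective_vecCons {α : Type*} {n : ℕ} {x : α} {f : Fin n → α} (hx : ∀ i, x ≠ f i)
    (hf : Function.Injective f) : Function.Injective (Matrix.vecCons x f) :=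
  Fin.cons_injective_iff.2 ⟨fun ⟨i, hi⟩ ↦ hx i hi.symm, hf⟩

theorem injective_pair {α : Type*} {x y : α} (h : x ≠ y) : Function.Injective ![x, y] :=
  injective_vecCons (fun _ ↦ by simpa using h) (Function.injective_of_subsingleton _)

theorem injective_triple {α : Type*} {x y z : α} (hxy : x ≠ y) (hxz : x ≠ z) (hyz : y ≠ z) :
    Function.Injective ![x, y, z] :=
  injective_vecCons (Fin.forall_fin_two.2 ⟨hxy, hxz⟩) (injective_pair hyz)

end LineCount

/-- each count in {0,1,2,3,5,7,9,15,27} is realized by a smooth cubic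
surface over any number field `k`. -/
theorem exists_smooth_cubic_number_field_with_line_count
    (k : Type*) [Field k] [NumberField k] :
    ∀ n ∈ ({0, 1, 2, 3, 5, 7, 9, 15, 27} : Set ℕ),
      ∃ f : MvPolynomial (Fin 4) k, IsSmoothCubic k f ∧
        {W : Submodule k (Fin 4 → k) | IsLineOn f W}.Finite ∧
        {W : Submodule k (Fin 4 → k) | IsLineOn f W}.ncard = n := by
  intro n hn
  obtain ⟨v, a, ha⟩ := exists_intValuation_eq_exp_neg_one k
  have hL := monic_irreducible_natDegree_X_sub_C (k := k)
  have hE {n : ℕ} (hn : n ≠ 0) := monic_irreducible_natDegree_X_pow_sub_C (k := k) ha hn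
  have hE' := monic_irreducible_natDegree_X_pow_sub_C (k := k) (intValuation_mul_one_sub ha)
    two_ne_zero
  have ha0 : algebraMap (NumberField.RingOfIntegers k) k a ≠ 0 := fun h ↦
    sq_ne_of_intValuation k ha 0 (by simp [h])
  have hne {p q : Polynomial k} (h : p.natDegree ≠ q.natDegree) : p ≠ q := ne_of_apply_ne _ h
  have hLE (c : k) {n : ℕ} (hn : 1 < n) : (.X - .C c : Polynomial k) ≠
      .X ^ n - .C (algebraMap (NumberField.RingOfIntegers k) k a) :=
    hne (by simpa only [hL, hE hn.ne_bot] using hn.ne)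
  have h01 : (.X - .C 0 : Polynomial k) ≠ .X - .C 1 := X_sub_C_injective.ne zero_ne_one
  have hE2 : (.X ^ 2 - .C (algebraMap (NumberField.RingOfIntegers k) k a) : Polynomial k) ≠
      .X ^ 2 - .C (algebraMap (NumberField.RingOfIntegers k) k (a * (1 - a))) := by
    refine sub_right_injective.ne (Polynomial.C_injective.ne fun h ↦ ha0 ?_)
    rw [map_mul, map_sub, map_one] at h
    exact pow_eq_zero_iff two_ne_zero |>.1 (by linear_combination h)
  rcases hn with rfl | rfl | rfl | rfl | rfl | rfl | rfl | rfl | rfl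
  · obtain ⟨f, hf, h⟩ := exists_isSmoothCubic_setOf_isLineOn_eq_empty ha0
      fun x y z ↦ eq_zero_of_cube_add_cube k ha
    exact ⟨f, hf, by simp [h]⟩
  · have ha' : v.intValuation (a * (a - 1)) = WithZero.exp (-1 : ℤ) := by
      rw [← intValuation_mul_one_sub ha, ← Valuation.map_neg]
      ring_nf
    obtain ⟨f, hf, W, h⟩ := exists_isSmoothCubic_setOf_isLineOn_eq_singleton
      (sq_ne_of_intValuation k ha) (by simpa using sq_ne_of_intValuation k ha')
    exact ⟨f, hf, by simp [h]⟩
  · exact exists_isSmoothCubic_ncard_eq (fun _ : Fin 1 ↦ _) (fun _ ↦ 5)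
      (fun _ ↦ hE (n := 5) (by norm_num)) (Function.injective_of_subsingleton _) rfl (by decide)
  · exact exists_isSmoothCubic_ncard_eq ![_, _] ![2, 3]
      (Fin.forall_fin_two.2 ⟨hE two_ne_zero, hE three_ne_zero⟩)
      (injective_pair (hne (by simp [hE]))) rfl (by decide)
  · exact exists_isSmoothCubic_ncard_eq ![_, _] ![1, 4]
      (Fin.forall_fin_two.2 ⟨hL 0, hE four_ne_zero⟩)
      (injective_pair (hLE _ (by decide))) rfl (by decide)
  · exact exists_isSmoothCubic_ncard_eq ![_, _, _] ![1, 2, 2]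
      (Fin.forall_fin_succ.2 ⟨hL 0, Fin.forall_fin_two.2 ⟨hE two_ne_zero, hE'⟩⟩)
      (injective_triple (hLE _ (by decide)) (hne (by simp only [hL, hE']; norm_num)) hE2) rfl
      (by decide)
  · exact exists_isSmoothCubic_ncard_eq ![_, _, _] ![1, 1, 3]
      (Fin.forall_fin_succ.2 ⟨hL 0, Fin.forall_fin_two.2 ⟨hL 1, hE three_ne_zero⟩⟩)
      (injective_triple h01 (hLE _ (by decide)) (hLE _ (by decide))) rfl (by decide)
  · exact exists_isSmoothCubic_ncard_eq ![_, _, _, _] ![1, 1, 1, 2]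
      (Fin.forall_fin_succ.2 ⟨hL 0, Fin.forall_fin_succ.2 ⟨hL 1,
        Fin.forall_fin_two.2 ⟨hL 2, hE two_ne_zero⟩⟩⟩)
      (injective_vecCons (Fin.forall_fin_succ.2 ⟨h01, Fin.forall_fin_two.2
          ⟨X_sub_C_injective.ne two_ne_zero.symm, hLE _ (by decide)⟩⟩)
        (injective_triple (X_sub_C_injective.ne (by norm_num)) (hLE _ (by decide))
          (hLE _ (by decide)))) rfl (by decide)
  · have hinj : Function.Injective fun i : Fin 5 ↦ (.X - .C (i.val : k) : Polynomial k) :=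
      X_sub_C_injective.comp (Nat.cast_injective.comp Fin.val_injective)
    exact exists_isSmoothCubic_ncard_eq _ (fun _ ↦ 1) (fun i ↦ hL i.val) hinj rfl
      (by decide +kernel)
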